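/- Let M > 0 and let A_N, B_N be (M,0)-regular sequences of normal matrices with limit moments Φ, Ψ. Suppose there is R > 0 such that I_N(z;A_N,B_N) ≠ 0 for all |z| < R and all N ≥ 1, set r = min(R, (2/27)·M^{−2}), and for each N let F_N be the unique free-energy branch for I_N(·;A_N,B_N) on D(0,r). Then for every z_0 with |z_0| < r, F_N(z_0) → C_0(z_0;Φ,Ψ) = Σ_{d=1}^∞ C_{0,d}(Φ,Ψ) z_0^d/d! as N → ∞. -/

import Mathlib

open MeasureTheory Matrix

namespace HCIZ

noncomputable instance (N : ℕ) : MeasurableSpace (Matrix (Fin N) (Fin N) ℂ) := borel _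

instance (N : ℕ) : BorelSpace (Matrix (Fin N) (Fin N) ℂ) := ⟨rfl⟩

/-- The number of cycles of a permutation (fixed points counted as cycles). -/
def cycleCount {d : ℕ} (π : Equiv.Perm (Fin d)) : ℕ := π.partition.parts.card

/-- `π` has cycle type `α` (1-cycles included). -/
def HasCycleType {d : ℕ} (π : Equiv.Perm (Fin d)) (α : d.Partition) : Prop :=
  π.partition.parts = α.parts

/-- The tuple `τ` consists of transpositions `(s_i t_i)`, `s_i < t_i`, with
`t_1 ≤ t_2 ≤ ⋯` (monotone condition). -/
def IsMonotoneTuple {d r : ℕ} (τ : Fin r → Equiv.Perm (Fin d)) : Prop :=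
  (∀ i, (τ i).IsSwap) ∧ Monotone fun i => (τ i).support.max

/-- The subgroup generated by `s` acts transitively on `Fin d`. -/
def GeneratesTransitively {d : ℕ} (s : Set (Equiv.Perm (Fin d))) : Prop :=
  ∀ x y : Fin d, ∃ g ∈ Subgroup.closure s, g x = y

/-- `H⃗^r(α,β)`: the number of monotone transitive factorizations of the identity
into `ρ σ τ_1 ⋯ τ_r` with `ρ` of cycle type `α` and `σ` of cycle type `β`. -/
noncomputable def Hr (d : ℕ) (α β : d.Partition) (r : ℕ) : ℕ :=
  Nat.card {T : Equiv.Perm (Fin d) × Equiv.Perm (Fin d) × (Fin r → Equiv.Perm (Fin d)) //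
    HasCycleType T.1 α ∧ HasCycleType T.2.1 β ∧ IsMonotoneTuple T.2.2 ∧
    T.1 * T.2.1 * (List.ofFn T.2.2).prod = 1 ∧
    GeneratesTransitively ({T.1, T.2.1} ∪ Set.range T.2.2)}

/-- `H̃^r(α,β)`: the same count without the transitivity requirement. -/
noncomputable def Hnt (d : ℕ) (α β : d.Partition) (r : ℕ) : ℕ :=
  Nat.card {T : Equiv.Perm (Fin d) × Equiv.Perm (Fin d) × (Fin r → Equiv.Perm (Fin d)) //
    HasCycleType T.1 α ∧ HasCycleType T.2.1 β ∧ IsMonotoneTuple T.2.2 ∧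
    T.1 * T.2.1 * (List.ofFn T.2.2).prod = 1}

/-- The monotone double Hurwitz number `H⃗_g(α,β) = H⃗^r(α,β)`,
`r = 2g - 2 + ℓ(α) + ℓ(β)`. -/
noncomputable def Hg (d g : ℕ) (α β : d.Partition) : ℕ :=
  Hr d α β (2 * g + α.parts.card + β.parts.card - 2)

/-- `m_r(π)`: monotone (not necessarily transitive) factorizations of `π`
into `r` transpositions. -/
noncomputable def mcount (d r : ℕ) (π : Equiv.Perm (Fin d)) : ℕ :=
  Nat.card {τ : Fin r → Equiv.Perm (Fin d) //
    IsMonotoneTuple τ ∧ (List.ofFn τ).prod = π}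

/-- Power sum `p_α(A) = ∏ Tr(A^{α_i})`. -/
noncomputable def pPoly {N : ℕ} (A : Matrix (Fin N) (Fin N) ℂ) {d : ℕ} (α : d.Partition) : ℂ :=
  (α.parts.map fun k => (A ^ k).trace).prod

/-- `φ_α = ∏ φ_{α_i}`. -/
noncomputable def momProd (Φ : ℕ → ℂ) {d : ℕ} (α : d.Partition) : ℂ :=
  (α.parts.map Φ).prod

/-- `C_{g,d}(A,B) = ∑_{α,β ⊢ d} (-1)^{d+ℓ(α)+ℓ(β)} H⃗_g(α,β)
(N^{-ℓ(α)} p_α(A)) (N^{-ℓ(β)} p_β(B))`. -/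
noncomputable def Cmat {N : ℕ} (g d : ℕ) (A B : Matrix (Fin N) (Fin N) ℂ) : ℂ :=
  ∑ α : d.Partition, ∑ β : d.Partition,
    (-1 : ℂ) ^ (d + α.parts.card + β.parts.card) * (Hg d g α β : ℂ) *
      (((N : ℂ) ^ α.parts.card)⁻¹ * pPoly A α) * (((N : ℂ) ^ β.parts.card)⁻¹ * pPoly B β)

/-- `C_{g,d}(Φ,Ψ) = ∑_{α,β ⊢ d} (-1)^{d+ℓ(α)+ℓ(β)} H⃗_g(α,β) φ_α ψ_β`. -/
noncomputable def Cseq (g d : ℕ) (Φ Ψ : ℕ → ℂ) : ℂ :=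
  ∑ α : d.Partition, ∑ β : d.Partition,
    (-1 : ℂ) ^ (d + α.parts.card + β.parts.card) * (Hg d g α β : ℂ) *
      momProd Φ α * momProd Ψ β

/-- The HCIZ integral `I_N(z;A,B)` with respect to a measure `μ` on `U(N)`. -/
noncomputable def hciz {N : ℕ} (μ : Measure (Matrix.unitaryGroup (Fin N) ℂ))
    (A B : Matrix (Fin N) (Fin N) ℂ) (z : ℂ) : ℂ :=
  ∫ U : Matrix.unitaryGroup (Fin N) ℂ,
    Complex.exp (-(z * (N : ℂ) *
      (A * (U : Matrix (Fin N) (Fin N) ℂ) * B *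
        ((U⁻¹ : Matrix.unitaryGroup (Fin N) ℂ) : Matrix (Fin N) (Fin N) ℂ)).trace)) ∂μ

/-- A free-energy branch for `I_N(·;A,B)` on the disc `D(0,ε)`: a holomorphic
function `F` with `F 0 = 0` and `exp (N² F z) = I_N(z;A,B)` on the disc. -/
def IsFreeEnergyBranch {N : ℕ} (μ : Measure (Matrix.unitaryGroup (Fin N) ℂ))
    (A B : Matrix (Fin N) (Fin N) ℂ) (ε : ℝ) (F : ℂ → ℂ) : Prop :=
  DifferentiableOn ℂ F (Metric.ball 0 ε) ∧ F 0 = 0 ∧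
    ∀ z ∈ Metric.ball (0 : ℂ) ε, Complex.exp ((N : ℂ) ^ 2 * F z) = hciz μ A B z

/-- The L² operator norm of a matrix. -/
noncomputable def opNorm {N : ℕ} (A : Matrix (Fin N) (Fin N) ℂ) : ℝ :=
  ‖Matrix.toEuclideanCLM (𝕜 := ℂ) A‖

/-- The all-ones partition `(1^d)`. -/
def onesPartition (d : ℕ) : d.Partition :=
  ⟨Multiset.replicate d 1, fun {i} hi => by
    rw [Multiset.eq_of_mem_replicate hi]; exact one_pos, by simp⟩

/-- The partition `(2,1^{d-2})` of `d`, for `d ≥ 2`. -/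
def twoOnesPartition (d : ℕ) (hd : 2 ≤ d) : d.Partition :=
  ⟨2 ::ₘ Multiset.replicate (d - 2) 1, fun {i} hi => by
    rcases Multiset.mem_cons.mp hi with h | h
    · omega
    · rw [Multiset.eq_of_mem_replicate h]; exact one_pos, by
    simp [Multiset.sum_cons]; omega⟩


/-- `C_0(z;Φ,Ψ) = ∑_{d ≥ 1} C_{0,d}(Φ,Ψ) z^d/d!`, the generating function for
genus zero monotone double Hurwitz numbers. -/
noncomputable def C0fun (Φ Ψ : ℕ → ℂ) (z : ℂ) : ℂ :=
  ∑' d : ℕ, Cseq 0 (d + 1) Φ Ψ * z ^ (d + 1) / ((d + 1).factorial : ℂ)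

/-- Locally bounded-above real parts and convergence of Taylor coefficients at the origin imply
pointwise convergence. -/
theorem tendsto_of_re_le_of_tendsto_iteratedDeriv {F : ℕ → ℂ → ℂ} {r K : ℝ} {c : ℕ → ℂ}
    (hK : 0 < K)
    (hF : ∀ N, 1 ≤ N → DifferentiableOn ℂ (F N) (Metric.ball 0 r))
    (hF0 : ∀ N, 1 ≤ N → F N 0 = 0)
    (hre : ∀ N, 1 ≤ N → ∀ z ∈ Metric.ball (0 : ℂ) r, (F N z).re ≤ K)
    (hc : ∀ d, Filter.Tendsto (fun N => iteratedDeriv (d + 1) (F N) 0) Filter.atTop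
      (nhds (c (d + 1))))
    {z : ℂ} (hz : ‖z‖ < r) :
    Filter.Tendsto (fun N => F N z) Filter.atTop
      (nhds (∑' d : ℕ, c (d + 1) * z ^ (d + 1) / ((d + 1).factorial : ℂ))) := by
  obtain ⟨s, hzs, hsr⟩ := exists_between hz
  have hs : 0 < s := (norm_nonneg z).trans_lt hzs
  have hr : 0 < r := hs.trans hsr
  set C : ℝ := 2 * K * s / (r - s) with hC
  have hsum : ∀ N, 1 ≤ N →
      F N z = ∑' d : ℕ, iteratedDeriv (d + 1) (F N) 0 * z ^ (d + 1) / ((d + 1).factorial : ℂ) := by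
    intro N hN
    have h := Complex.hasSum_taylorSeries_on_ball (hF N hN) (z := z) (by simpa using hz)
    have h' := (hasSum_nat_add_iff' 1).mpr h
    simp only [Finset.range_one, Finset.sum_singleton, iteratedDeriv_zero, hF0 N hN] at h'
    simp only [smul_zero, sub_zero] at h'
    rw [← h'.tsum_eq]
    refine tsum_congr fun d => ?_
    simp only [smul_eq_mul]
    ring
  have hbd : ∀ N, 1 ≤ N → ∀ d, ‖iteratedDeriv (d + 1) (F N) 0 * z ^ (d + 1) /
      ((d + 1).factorial : ℂ)‖ ≤ C * (‖z‖ / s) ^ (d + 1) := by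
    intro N hN d
    have h1 : ‖iteratedDeriv (d + 1) (F N) 0‖ ≤ (d + 1).factorial * C / s ^ (d + 1) := by
      refine Complex.norm_iteratedDeriv_le_of_forall_mem_sphere_norm_le _ hs ?_ ?_
      · refine DifferentiableOn.diffContOnCl ((hF N hN).mono ?_)
        exact Metric.closure_ball_subset_closedBall.trans (Metric.closedBall_subset_ball hsr)
      · intro w hw
        have hw' : ‖w‖ = s := by simpa using hw
        have := Complex.borelCaratheodory_zero (z := w) hK (hF N hN) (hre N hN) hr
          (by simpa [hw'] using hsr) (hF0 N hN)
        rwa [hw'] at this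
    have hf : (0 : ℝ) < (d + 1).factorial := by positivity
    rw [norm_div, norm_mul, norm_pow, Complex.norm_natCast, div_le_iff₀ hf]
    calc _ ≤ ((d + 1).factorial * C / s ^ (d + 1)) * ‖z‖ ^ (d + 1) := by gcongr
      _ = _ := by rw [div_pow]; ring
  have hlim : Filter.Tendsto (fun N => ∑' d : ℕ, iteratedDeriv (d + 1) (F N) 0 * z ^ (d + 1) /
      ((d + 1).factorial : ℂ)) Filter.atTop
      (nhds (∑' d : ℕ, c (d + 1) * z ^ (d + 1) / ((d + 1).factorial : ℂ))) := by
    refine tendsto_tsum_of_dominated_convergence (bound := fun d => C * (‖z‖ / s) ^ (d + 1))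
      ?_ ?_ ?_
    · refine Summable.mul_left _ ?_
      exact (summable_nat_add_iff 1).mpr (summable_geometric_of_lt_one (by positivity)
        ((div_lt_one hs).mpr hzs))
    · intro d
      exact ((hc d).mul_const _).div_const _
    · filter_upwards [Filter.eventually_ge_atTop 1] with N hN d using hbd N hN d
  refine hlim.congr' ?_
  filter_upwards [Filter.eventually_ge_atTop 1] with N hN using (hsum N hN).symm

/-- The derivatives of `exp ∘ f` at a point in terms of those of `f`. -/
theorem iteratedDeriv_exp_comp_succ {f : ℂ → ℂ} {x : ℂ} (hf : AnalyticAt ℂ f x) (n : ℕ) :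
    iteratedDeriv (n + 1) (fun z => Complex.exp (f z)) x =
      ∑ k ∈ Finset.range (n + 1), (n.choose k : ℂ) * iteratedDeriv (k + 1) f x *
        iteratedDeriv (n - k) (fun z => Complex.exp (f z)) x := by
  have hexp : AnalyticAt ℂ (fun z => Complex.exp (f z)) x := hf.cexp
  have hev : deriv (fun z => Complex.exp (f z)) =ᶠ[nhds x]
      fun z => deriv f z * Complex.exp (f z) := by
    filter_upwards [hf.eventually_analyticAt] with z hz
    rw [(hz.differentiableAt.hasDerivAt.cexp).deriv, mul_comm]
  rw [iteratedDeriv_succ', hev.iteratedDeriv_eq,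
    iteratedDeriv_fun_mul hf.deriv.contDiffAt hexp.contDiffAt]
  refine Finset.sum_congr rfl fun k _ => ?_
  rw [iteratedDeriv_succ']

section Norm
open scoped Matrix.Norms.L2Operator

theorem norm_apply_le_opNorm {N : ℕ} (A : Matrix (Fin N) (Fin N) ℂ) (i j : Fin N) :
    ‖A i j‖ ≤ opNorm A := by
  have h := (Matrix.toEuclideanCLM (𝕜 := ℂ) A).le_opNorm (EuclideanSpace.single j 1)
  have h2 := PiLp.norm_apply_le (Matrix.toEuclideanCLM (𝕜 := ℂ) A (EuclideanSpace.single j 1)) i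
  have h3 : (Matrix.toEuclideanCLM (𝕜 := ℂ) A (EuclideanSpace.single j 1)) i = A i j := by
    rw [Matrix.ofLp_toEuclideanCLM]; simp
  rw [h3] at h2
  refine h2.trans (h.trans ?_)
  simp [opNorm]

theorem norm_trace_conj_le {N : ℕ} {A B : Matrix (Fin N) (Fin N) ℂ} {M : ℝ} (hM : 0 ≤ M)
    (hA : opNorm A ≤ M) (hB : opNorm B ≤ M) (U : Matrix.unitaryGroup (Fin N) ℂ) :
    ‖(A * (U : Matrix (Fin N) (Fin N) ℂ) * B *
        ((U⁻¹ : Matrix.unitaryGroup (Fin N) ℂ) : Matrix (Fin N) (Fin N) ℂ)).trace‖ ≤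
      N * M ^ 2 := by
  have hnorm : opNorm (A * (U : Matrix (Fin N) (Fin N) ℂ) * B *
        ((U⁻¹ : Matrix.unitaryGroup (Fin N) ℂ) : Matrix (Fin N) (Fin N) ℂ)) ≤ M ^ 2 := by
    change ‖_‖ ≤ _
    change ‖A‖ ≤ _ at hA
    change ‖B‖ ≤ _ at hB
    have h1 := CStarRing.norm_mul_coe_unitary (A * (U : Matrix (Fin N) (Fin N) ℂ) * B) U⁻¹
    have h2 := CStarRing.norm_mul_coe_unitary A U
    refine h1.le.trans ?_
    calc _ ≤ ‖A * (U : Matrix (Fin N) (Fin N) ℂ)‖ * ‖B‖ := norm_mul_le _ _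
      _ ≤ M * M := by rw [h2]; gcongr
      _ = _ := by ring
  calc _ ≤ ∑ i : Fin N, ‖_‖ := norm_sum_le _ _
    _ ≤ ∑ i : Fin N, M ^ 2 := Finset.sum_le_sum fun i _ => (norm_apply_le_opNorm _ i i).trans hnorm
    _ = _ := by simp

end Norm

instance compactSpace_unitaryGroup (N : ℕ) : CompactSpace (Matrix.unitaryGroup (Fin N) ℂ) := by
  refine (isCompact_iff_compactSpace
    (s := (Matrix.unitaryGroup (Fin N) ℂ : Set (Matrix (Fin N) (Fin N) ℂ)))).mp ?_
  have hK : IsCompact (Set.univ.pi fun _ : Fin N => Set.univ.pi fun _ : Fin N =>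
      Metric.closedBall (0 : ℂ) 1) :=
    isCompact_univ_pi fun _ => isCompact_univ_pi fun _ => isCompact_closedBall _ _
  refine hK.of_isClosed_subset
    (t := (Matrix.unitaryGroup (Fin N) ℂ : Set (Matrix (Fin N) (Fin N) ℂ))) ?_ ?_
  · have : (Matrix.unitaryGroup (Fin N) ℂ : Set (Matrix (Fin N) (Fin N) ℂ)) =
        {U | U * star U = 1} := by
      ext U
      exact Matrix.mem_unitaryGroup_iff
    rw [this]
    exact isClosed_eq (by fun_prop) continuous_const
  · intro U hU i _ j _
    simpa using entry_norm_bound_of_unitary hU i j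

theorem continuous_conj {N : ℕ} (B : Matrix (Fin N) (Fin N) ℂ) :
    Continuous fun U : Matrix.unitaryGroup (Fin N) ℂ =>
      (U : Matrix (Fin N) (Fin N) ℂ) * B *
        ((U⁻¹ : Matrix.unitaryGroup (Fin N) ℂ) : Matrix (Fin N) (Fin N) ℂ) :=
  (continuous_subtype_val.mul continuous_const).mul (continuous_subtype_val.comp continuous_inv)

section ExpIntegral

variable {G : Type*} [TopologicalSpace G] [CompactSpace G] [MeasurableSpace G] [BorelSpace G]
  (μ : Measure G) [IsProbabilityMeasure μ]

theorem integrable_of_continuous {f : G → ℂ} (hf : Continuous f) : Integrable f μ :=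
  hf.integrable_of_hasCompactSupport (HasCompactSupport.of_compactSpace f)

theorem iteratedDeriv_integral_cexp {c : G → ℂ} (hc : Continuous c) (n : ℕ) (z : ℂ) :
    iteratedDeriv n (fun z => ∫ g, Complex.exp (z * c g) ∂μ) z =
      ∫ g, c g ^ n * Complex.exp (z * c g) ∂μ := by
  induction n generalizing z with
  | zero => simp
  | succ n ih =>
    rw [iteratedDeriv_succ, funext ih]
    obtain ⟨K, hK⟩ := (isCompact_range hc).isBounded.exists_norm_le
    have hK' : ∀ g, ‖c g‖ ≤ K := fun g => hK _ ⟨g, rfl⟩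
    have h := hasDerivAt_integral_of_dominated_loc_of_deriv_le (μ := μ) (𝕜 := ℂ)
      (F := fun z g => c g ^ n * Complex.exp (z * c g))
      (F' := fun z g => c g ^ (n + 1) * Complex.exp (z * c g))
      (bound := fun g => ‖c g‖ ^ (n + 1) * Real.exp ((‖z‖ + 1) * K)) (x₀ := z)
      (Metric.ball_mem_nhds z one_pos)
      (Filter.Eventually.of_forall fun w =>
        (integrable_of_continuous μ (by fun_prop)).aestronglyMeasurable)
      (integrable_of_continuous μ (by fun_prop))
      (integrable_of_continuous μ (by fun_prop)).aestronglyMeasurable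
      (Filter.Eventually.of_forall fun g w hw => ?_)
      (Continuous.integrable_of_hasCompactSupport (by fun_prop)
        (HasCompactSupport.of_compactSpace _))
      (Filter.Eventually.of_forall fun g w hw => ?_)
    · exact h.2.deriv
    · rw [norm_mul, norm_pow, Complex.norm_exp]
      gcongr
      refine (Complex.re_le_norm _).trans ?_
      rw [norm_mul]
      gcongr
      · have : ‖w - z‖ < 1 := by simpa [dist_eq_norm] using hw
        have := norm_le_norm_sub_add w z
        linarith
      · exact hK' g
    · have h1 : HasDerivAt (fun w => Complex.exp (w * c g)) (Complex.exp (w * c g) * (1 * c g)) w :=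
        ((hasDerivAt_id w).mul_const (c g)).cexp
      convert! h1.const_mul (c g ^ n) using 1
      ring

end ExpIntegral

theorem norm_integral_cexp_le {G : Type*} [MeasurableSpace G] (μ : Measure G)
    [IsProbabilityMeasure μ] {c : G → ℂ} {K : ℝ} (hK : ∀ g, ‖c g‖ ≤ K) (z : ℂ) :
    ‖∫ g, Complex.exp (z * c g) ∂μ‖ ≤ Real.exp (‖z‖ * K) := by
  have := norm_integral_le_of_norm_le_const (μ := μ) (f := fun g => Complex.exp (z * c g))
    (C := Real.exp (‖z‖ * K)) (Filter.Eventually.of_forall fun g => by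
      rw [Complex.norm_exp]
      gcongr
      refine (Complex.re_le_norm _).trans ?_
      rw [norm_mul]
      gcongr
      exact hK g)
  simpa using this

theorem hciz_eq {N : ℕ} (μ : Measure (Matrix.unitaryGroup (Fin N) ℂ))
    (A B : Matrix (Fin N) (Fin N) ℂ) :
    hciz μ A B = fun z => ∫ U : Matrix.unitaryGroup (Fin N) ℂ, Complex.exp (z * -((N : ℂ) *
      (A * ((U : Matrix (Fin N) (Fin N) ℂ) * B *
        ((U⁻¹ : Matrix.unitaryGroup (Fin N) ℂ) : Matrix (Fin N) (Fin N) ℂ))).trace)) ∂μ := by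
  funext z
  unfold hciz
  congr 1
  funext U
  simp only [Matrix.mul_assoc]
  congr 1
  ring

theorem iteratedDeriv_hciz {N : ℕ} (μ : Measure (Matrix.unitaryGroup (Fin N) ℂ))
    [IsProbabilityMeasure μ] (A B : Matrix (Fin N) (Fin N) ℂ) (n : ℕ) :
    iteratedDeriv n (hciz μ A B) 0 = (-(N : ℂ)) ^ n * ∫ U : Matrix.unitaryGroup (Fin N) ℂ,
      (A * ((U : Matrix (Fin N) (Fin N) ℂ) * B *
        ((U⁻¹ : Matrix.unitaryGroup (Fin N) ℂ) : Matrix (Fin N) (Fin N) ℂ))).trace ^ n ∂μ := by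
  rw [hciz_eq, iteratedDeriv_integral_cexp, ← integral_const_mul]
  · congr 1
    funext U
    simp only [zero_mul, Complex.exp_zero, mul_one]
    rw [← mul_pow, neg_mul]
  · exact (continuous_const.mul
      ((continuous_const.mul (continuous_conj B)).matrix_trace)).neg

theorem norm_hciz_le {N : ℕ} (μ : Measure (Matrix.unitaryGroup (Fin N) ℂ))
    [IsProbabilityMeasure μ] {A B : Matrix (Fin N) (Fin N) ℂ} {M : ℝ} (hM : 0 ≤ M)
    (hA : opNorm A ≤ M) (hB : opNorm B ≤ M) (z : ℂ) :
    ‖hciz μ A B z‖ ≤ Real.exp (‖z‖ * (N ^ 2 * M ^ 2)) := by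
  rw [hciz_eq]
  refine norm_integral_cexp_le μ (fun U => ?_) z
  have := norm_trace_conj_le hM hA hB U
  rw [norm_neg, norm_mul, Complex.norm_natCast, ← Matrix.mul_assoc, ← Matrix.mul_assoc]
  calc _ ≤ (N : ℝ) * (N * M ^ 2) := by gcongr
    _ = _ := by ring

section Tensor

variable {α : Type*} [Fintype α] {N : ℕ}

/-- The tensor power `x^{⊗ α}` of a matrix. -/
def tpow (α : Type*) [Fintype α] {N : ℕ} (x : Matrix (Fin N) (Fin N) ℂ) :
    Matrix (α → Fin N) (α → Fin N) ℂ :=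
  Matrix.of fun i j => ∏ k, x (i k) (j k)

theorem tpow_one : tpow α (1 : Matrix (Fin N) (Fin N) ℂ) = 1 := by
  ext i j
  simp only [tpow, Matrix.of_apply, Matrix.one_apply]
  by_cases h : i = j
  · simp [h]
  · obtain ⟨k, hk⟩ := Function.ne_iff.mp h
    rw [if_neg h, Finset.prod_eq_zero (Finset.mem_univ k) (by simp [hk])]

theorem tpow_diagonal (D : Fin N → ℂ) :
    tpow α (Matrix.diagonal D) = Matrix.diagonal fun i : α → Fin N => ∏ k, D (i k) := by
  ext i j
  by_cases h : i = j
  · simp [tpow, h]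
  · obtain ⟨k, hk⟩ := Function.ne_iff.mp h
    rw [Matrix.diagonal_apply_ne _ h, tpow, Matrix.of_apply,
      Finset.prod_eq_zero (Finset.mem_univ k) (by simp [hk])]

variable [DecidableEq α]

theorem tpow_mul (x y : Matrix (Fin N) (Fin N) ℂ) : tpow α (x * y) = tpow α x * tpow α y := by
  ext i j
  simp only [tpow, Matrix.of_apply, Matrix.mul_apply, Finset.prod_univ_sum, Fintype.piFinset_univ,
    Finset.prod_mul_distrib]

/-- The action of a permutation on tensors by permuting the factors. -/
def permMat (N : ℕ) (σ : Equiv.Perm α) : Matrix (α → Fin N) (α → Fin N) ℂ :=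
  Matrix.of fun i j => if i = j ∘ σ then 1 else 0

theorem permMat_mul_apply (σ : Equiv.Perm α) (Y : Matrix (α → Fin N) (α → Fin N) ℂ)
    (i j : α → Fin N) : (permMat N σ * Y) i j = Y (i ∘ σ.symm) j := by
  rw [Matrix.mul_apply, Finset.sum_eq_single (i ∘ σ.symm)]
  · simp [permMat, Function.comp_assoc]
  · intro l _ hl
    rw [permMat, Matrix.of_apply, if_neg, zero_mul]
    rintro rfl
    simp [Function.comp_assoc] at hl
  · simp

theorem mul_permMat_apply (σ : Equiv.Perm α) (Y : Matrix (α → Fin N) (α → Fin N) ℂ)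
    (i j : α → Fin N) : (Y * permMat N σ) i j = Y i (j ∘ σ) := by
  rw [Matrix.mul_apply, Finset.sum_eq_single (j ∘ σ)]
  · simp [permMat]
  · intro l _ hl
    rw [permMat, Matrix.of_apply, if_neg hl, mul_zero]
  · simp

theorem permMat_mul (σ τ : Equiv.Perm α) : permMat N σ * permMat N τ = permMat N (τ * σ) := by
  ext i j
  rw [mul_permMat_apply]
  simp only [permMat, Matrix.of_apply, Function.comp_assoc, Equiv.Perm.coe_mul]
  rfl

theorem commute_permMat_tpow (σ : Equiv.Perm α) (x : Matrix (Fin N) (Fin N) ℂ) :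
    Commute (permMat N σ) (tpow α x) := by
  ext i j
  rw [permMat_mul_apply, mul_permMat_apply]
  simp only [tpow, Matrix.of_apply, Function.comp_apply]
  rw [← Equiv.prod_comp σ]
  simp

theorem commute_diagonal_iff (T : Matrix (α → Fin N) (α → Fin N) ℂ) (E : (α → Fin N) → ℂ) :
    Commute T (Matrix.diagonal E) ↔ ∀ i j, T i j ≠ 0 → E i = E j := by
  constructor
  · intro h i j hT
    have := congrFun (congrFun h.eq i) j
    rw [Matrix.mul_diagonal, Matrix.diagonal_mul, mul_comm] at this
    exact (mul_right_cancel₀ hT this).symm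
  · intro h
    ext i j
    rw [Matrix.mul_diagonal, Matrix.diagonal_mul, mul_comm]
    by_cases hT : T i j = 0
    · simp [hT]
    · rw [h i j hT]

theorem exists_eq_comp_of_commute {T : Matrix (α → Fin N) (α → Fin N) ℂ}
    (hT : ∀ U : Matrix.unitaryGroup (Fin N) ℂ, Commute T (tpow α (U : Matrix (Fin N) (Fin N) ℂ)))
    {i j : α → Fin N} (hij : T i j ≠ 0) : ∃ σ : Equiv.Perm α, i = j ∘ σ := by
  have hcount : ∀ a, (Finset.univ.filter fun k => i k = a).card =
      (Finset.univ.filter fun k => j k = a).card := by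
    intro a
    have hζ := Complex.isPrimitiveRoot_exp (Fintype.card α + 1) (Nat.succ_ne_zero _)
    set ζ := Complex.exp (2 * Real.pi * Complex.I / (Fintype.card α + 1 : ℕ)) with hζdef
    have hn : ‖ζ‖ = 1 := hζ.norm'_eq_one (Nat.succ_ne_zero _)
    set D : Fin N → ℂ := fun b => if b = a then ζ else 1 with hD
    have hU : Matrix.diagonal D ∈ Matrix.unitaryGroup (Fin N) ℂ := by
      rw [Matrix.mem_unitaryGroup_iff, Matrix.star_eq_conjTranspose,
        Matrix.diagonal_conjTranspose, Matrix.diagonal_mul_diagonal, ← Matrix.diagonal_one]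
      congr 1
      funext b
      simp only [hD, Pi.star_apply]
      split_ifs
      · rw [RCLike.star_def, Complex.mul_conj, Complex.normSq_eq_norm_sq, hn]; simp
      · simp
    have h := hT ⟨_, hU⟩
    rw [tpow_diagonal, commute_diagonal_iff] at h
    have h2 := h i j hij
    simp only [hD, Finset.prod_ite, Finset.prod_const, one_pow, mul_one] at h2
    refine hζ.pow_inj ?_ ?_ h2 <;> exact Nat.lt_succ_of_le (Finset.card_le_univ _)
  have hcard : ∀ a, Nonempty ({k // i k = a} ≃ {k // j k = a}) := fun a =>
    ⟨Fintype.equivOfCardEq (by rw [Fintype.card_subtype, Fintype.card_subtype, hcount a])⟩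
  refine ⟨(Equiv.sigmaFiberEquiv i).symm.trans ((Equiv.sigmaCongrRight fun a =>
    (hcard a).some).trans (Equiv.sigmaFiberEquiv j)), ?_⟩
  funext k
  exact ((hcard (i k)).some ⟨k, rfl⟩).2.symm

theorem commute_tpow_diagonal {T : Matrix (α → Fin N) (α → Fin N) ℂ}
    (hT : ∀ U : Matrix.unitaryGroup (Fin N) ℂ, Commute T (tpow α (U : Matrix (Fin N) (Fin N) ℂ)))
    (D : Fin N → ℂ) : Commute T (tpow α (Matrix.diagonal D)) := by
  rw [tpow_diagonal, commute_diagonal_iff]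
  intro i j hij
  obtain ⟨σ, rfl⟩ := exists_eq_comp_of_commute hT hij
  exact Equiv.prod_comp σ fun k => D (j k)

theorem commute_tpow_isHermitian {T : Matrix (α → Fin N) (α → Fin N) ℂ}
    (hT : ∀ U : Matrix.unitaryGroup (Fin N) ℂ, Commute T (tpow α (U : Matrix (Fin N) (Fin N) ℂ)))
    {H : Matrix (Fin N) (Fin N) ℂ} (hH : H.IsHermitian) : Commute T (tpow α H) := by
  have h := hH.spectral_theorem
  rw [Unitary.conjStarAlgAut_apply] at h
  rw [h, tpow_mul, tpow_mul]
  have h1 := hT hH.eigenvectorUnitary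
  have h2 := hT (star hH.eigenvectorUnitary)
  exact (h1.mul_right (commute_tpow_diagonal hT _)).mul_right h2

theorem commute_tpow {T : Matrix (α → Fin N) (α → Fin N) ℂ}
    (hT : ∀ U : Matrix.unitaryGroup (Fin N) ℂ, Commute T (tpow α (U : Matrix (Fin N) (Fin N) ℂ)))
    (x : Matrix (Fin N) (Fin N) ℂ) : Commute T (tpow α x) := by
  obtain ⟨H₁, H₂, h₁, h₂, hx⟩ : ∃ H₁ H₂ : Matrix (Fin N) (Fin N) ℂ, H₁.IsHermitian ∧
      H₂.IsHermitian ∧ x = H₁ + Complex.I • H₂ :=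
    ⟨realPart x, imaginaryPart x, (realPart x).2, (imaginaryPart x).2,
      (realPart_add_I_smul_imaginaryPart x).symm⟩
  ext i j
  rw [← sub_eq_zero]
  set p : Polynomial ℂ := (∑ l, Polynomial.C (T i l) *
      ∏ k, (Polynomial.C (H₁ (l k) (j k)) + Polynomial.C (H₂ (l k) (j k)) * Polynomial.X)) -
    ∑ l, (∏ k, (Polynomial.C (H₁ (i k) (l k)) + Polynomial.C (H₂ (i k) (l k)) * Polynomial.X)) *
      Polynomial.C (T l j) with hp
  have heval : ∀ s : ℂ, p.eval s =
      (T * tpow α (H₁ + s • H₂)) i j - (tpow α (H₁ + s • H₂) * T) i j := by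
    intro s
    simp [hp, Matrix.mul_apply, tpow, mul_comm s, Polynomial.eval_finsetSum, Polynomial.eval_prod]
  have hp0 : p = 0 := by
    refine Polynomial.eq_zero_of_infinite_isRoot p ?_
    refine (Set.infinite_range_of_injective Complex.ofReal_injective).mono ?_
    rintro _ ⟨s, rfl⟩
    have hs : (H₁ + (s : ℂ) • H₂).IsHermitian := by
      refine h₁.add ?_
      rw [Matrix.IsHermitian, Matrix.conjTranspose_smul, h₂.eq]
      simp
    change p.eval _ = 0
    rw [heval, (commute_tpow_isHermitian hT hs).eq, sub_self]
  rw [hx, ← heval, hp0, Polynomial.eval_zero]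

/-- A form of the first fundamental theorem: an operator on tensors commuting with all unitary
tensor powers is a linear combination of permutations, if there are at most `N` tensor factors. -/
theorem exists_eq_sum_permMat {T : Matrix (α → Fin N) (α → Fin N) ℂ}
    (hT : ∀ U : Matrix.unitaryGroup (Fin N) ℂ, Commute T (tpow α (U : Matrix (Fin N) (Fin N) ℂ)))
    (hN : Fintype.card α ≤ N) :
    ∃ x : Equiv.Perm α → ℂ, T = ∑ σ, x σ • permMat N σ := by
  obtain ⟨v⟩ := Function.Embedding.nonempty_of_card_le (α := α) (β := Fin N) (by simpa using hN)
  refine ⟨fun σ => T (v ∘ σ) v, ?_⟩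
  ext i j
  set x : Matrix (Fin N) (Fin N) ℂ :=
    Matrix.of fun a b => if ∃ k, v k = b ∧ j k = a then 1 else 0 with hx
  have hxv : ∀ a k, x a (v k) = if a = j k then 1 else 0 := by
    intro a k
    simp [hx, eq_comm]
  have htx : ∀ (l : α → Fin N) (σ : Equiv.Perm α),
      tpow α x l (v ∘ σ) = if l = j ∘ σ then 1 else 0 := by
    intro l σ
    simp only [tpow, Matrix.of_apply, Function.comp_apply, hxv]
    rw [Finset.prod_ite_zero]
    simp [funext_iff]
  have h := congrFun (congrFun (commute_tpow hT x).eq i) v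
  rw [Matrix.mul_apply, Matrix.mul_apply, Finset.sum_eq_single j] at h
  · have h1 := htx j 1
    simp only [Equiv.Perm.coe_one, Function.comp_id, if_true] at h1
    rw [h1, mul_one] at h
    rw [h, Matrix.sum_apply]
    have hinj : Function.Injective fun σ : Equiv.Perm α => (v ∘ σ : α → Fin N) := by
      intro σ τ hστ
      ext k
      exact v.injective (congrFun hστ k)
    rw [← Finset.sum_subset (Finset.subset_univ (Finset.univ.image
      fun σ : Equiv.Perm α => (v ∘ σ : α → Fin N))), Finset.sum_image hinj.injOn]
    · refine Finset.sum_congr rfl fun σ _ => ?_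
      rw [htx, Matrix.smul_apply, permMat, Matrix.of_apply, smul_eq_mul, mul_comm]
    · intro l _ hl
      rw [mul_eq_zero]
      right
      by_contra hne
      obtain ⟨σ, hσ⟩ := exists_eq_comp_of_commute hT hne
      exact hl (Finset.mem_image.mpr ⟨σ, Finset.mem_univ _, hσ.symm⟩)
  · intro l _ hl
    have h1 : tpow α x l v = 0 := (htx l 1).trans (if_neg hl)
    rw [h1, mul_zero]
  · simp

end Tensor

section Moments

variable {α : Type*} [Fintype α] {N : ℕ}

theorem continuous_tpow_apply {X : Type*} [TopologicalSpace X]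
    {f : X → Matrix (Fin N) (Fin N) ℂ} (hf : Continuous f) (i j : α → Fin N) :
    Continuous fun x => tpow α (f x) i j :=
  continuous_finsetProd _ fun k _ => hf.matrix_elem (i k) (j k)

theorem mul_integral_mul_apply {X ι : Type*} [MeasurableSpace X] {μ : Measure X} [Fintype ι]
    {Y : X → Matrix ι ι ℂ} (hY : ∀ i j, Integrable (fun x => Y x i j) μ) (L K : Matrix ι ι ℂ)
    (i j : ι) :
    (L * Matrix.of (fun i j => ∫ x, Y x i j ∂μ) * K) i j = ∫ x, (L * Y x * K) i j ∂μ := by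
  simp only [Matrix.mul_apply, Matrix.of_apply, Finset.sum_mul]
  symm
  refine (integral_finsetSum _ fun l _ => integrable_finsetSum _ fun m _ =>
    ((hY m l).const_mul (L i m)).mul_const (K l j)).trans (Finset.sum_congr rfl fun l _ =>
      (integral_finsetSum _ fun m _ => ((hY m l).const_mul (L i m)).mul_const (K l j)).trans
        (Finset.sum_congr rfl fun m _ => ?_))
  exact (integral_mul_const _ _).trans (congrArg (· * K l j) (integral_const_mul _ _))

theorem trace_mul_integral {X ι : Type*} [MeasurableSpace X] {μ : Measure X} [Fintype ι]
    {Y : X → Matrix ι ι ℂ} (hY : ∀ i j, Integrable (fun x => Y x i j) μ) (L : Matrix ι ι ℂ) :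
    (L * Matrix.of (fun i j => ∫ x, Y x i j ∂μ)).trace = ∫ x, (L * Y x).trace ∂μ := by
  simp only [Matrix.trace, Matrix.diag_apply, Matrix.mul_apply, Matrix.of_apply]
  symm
  refine (integral_finsetSum _ fun l _ => integrable_finsetSum _ fun m _ =>
    (hY m l).const_mul (L l m)).trans (Finset.sum_congr rfl fun l _ =>
      (integral_finsetSum _ fun m _ => (hY m l).const_mul (L l m)).trans
        (Finset.sum_congr rfl fun m _ => ?_))
  exact integral_const_mul _ _

variable [DecidableEq α]

/-- The power sum attached to a permutation, as the trace of `A^{⊗ α}` against it. -/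
def permTrace (A : Matrix (Fin N) (Fin N) ℂ) (σ : Equiv.Perm α) : ℂ :=
  ∑ i : α → Fin N, ∏ k, A (i k) (i (σ k))

theorem trace_tpow_mul_permMat (A : Matrix (Fin N) (Fin N) ℂ) (σ : Equiv.Perm α) :
    (tpow α A * permMat N σ).trace = permTrace A σ := by
  simp [Matrix.trace, mul_permMat_apply, permTrace, tpow]

theorem trace_permMat (σ : Equiv.Perm α) : (permMat N σ).trace =
    permTrace (1 : Matrix (Fin N) (Fin N) ℂ) σ := by
  rw [← trace_tpow_mul_permMat, tpow_one, one_mul]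

theorem permTrace_conj (A : Matrix (Fin N) (Fin N) ℂ) (σ τ : Equiv.Perm α) :
    permTrace A (τ * σ * τ⁻¹) = permTrace A σ := by
  rw [← trace_tpow_mul_permMat, ← trace_tpow_mul_permMat, ← permMat_mul, ← permMat_mul,
    ← Matrix.mul_assoc, ← (commute_permMat_tpow _ _).eq, Matrix.mul_assoc, Matrix.trace_mul_comm,
    Matrix.mul_assoc, Matrix.mul_assoc, permMat_mul]
  have h1 : permMat N (1 : Equiv.Perm α) = 1 := by
    ext i j; simp [permMat, Matrix.one_apply]
  rw [inv_mul_cancel, h1, Matrix.mul_one]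

theorem trace_tpow (A : Matrix (Fin N) (Fin N) ℂ) :
    (tpow α A).trace = A.trace ^ Fintype.card α := by
  rw [← Finset.card_univ, ← Finset.prod_const, Matrix.trace, Matrix.trace, Finset.prod_univ_sum,
    Fintype.piFinset_univ]
  rfl

/-- Integrals of trace powers over the unitary group, expanded over permutations, with
coefficients subject to a linear system. -/
theorem exists_integral_trace_pow_eq (μ : Measure (Matrix.unitaryGroup (Fin N) ℂ))
    [μ.IsHaarMeasure] [IsProbabilityMeasure μ] (B : Matrix (Fin N) (Fin N) ℂ)
    (hN : Fintype.card α ≤ N) :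
    ∃ x : Equiv.Perm α → ℂ,
      (∀ A : Matrix (Fin N) (Fin N) ℂ, ∫ U : Matrix.unitaryGroup (Fin N) ℂ,
        (A * ((U : Matrix (Fin N) (Fin N) ℂ) * B *
          ((U⁻¹ : Matrix.unitaryGroup (Fin N) ℂ) : Matrix (Fin N) (Fin N) ℂ))).trace ^
            Fintype.card α ∂μ = ∑ σ, x σ * permTrace A σ) ∧
      ∀ π : Equiv.Perm α, permTrace B π = ∑ σ, x σ * permTrace (1 : Matrix (Fin N) (Fin N) ℂ)
        (π * σ) := by
  set X : Matrix.unitaryGroup (Fin N) ℂ → Matrix (Fin N) (Fin N) ℂ := fun U =>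
    (U : Matrix (Fin N) (Fin N) ℂ) * B *
      ((U⁻¹ : Matrix.unitaryGroup (Fin N) ℂ) : Matrix (Fin N) (Fin N) ℂ) with hX
  set T : Matrix (α → Fin N) (α → Fin N) ℂ :=
    Matrix.of fun i j => ∫ U, tpow α (X U) i j ∂μ with hTdef
  have hXc : Continuous X := continuous_conj B
  have hYint : ∀ i j, Integrable (fun U => tpow α (X U) i j) μ := fun i j =>
    integrable_of_continuous μ (continuous_tpow_apply hXc i j)
  have hlin : ∀ L : Matrix (α → Fin N) (α → Fin N) ℂ, (L * T).trace =
      ∫ U, (L * tpow α (X U)).trace ∂μ := fun L => trace_mul_integral hYint L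
  have hTV : ∀ V : Matrix.unitaryGroup (Fin N) ℂ,
      Commute T (tpow α (V : Matrix (Fin N) (Fin N) ℂ)) := by
    intro V
    have hVX : ∀ U, X (V * U) = V * X U *
        ((V⁻¹ : Matrix.unitaryGroup (Fin N) ℂ) : Matrix (Fin N) (Fin N) ℂ) := by
      intro U
      simp only [hX, _root_.mul_inv_rev, Submonoid.coe_mul, Matrix.mul_assoc]
    have hVV : ((V⁻¹ : Matrix.unitaryGroup (Fin N) ℂ) : Matrix (Fin N) (Fin N) ℂ) *
        (V : Matrix (Fin N) (Fin N) ℂ) = 1 := by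
      simp
    have hinv : T = tpow α (V : Matrix (Fin N) (Fin N) ℂ) * T *
        tpow α ((V⁻¹ : Matrix.unitaryGroup (Fin N) ℂ) : Matrix (Fin N) (Fin N) ℂ) := by
      ext i j
      have h1 : T i j = ∫ U, tpow α (X (V * U)) i j ∂μ :=
        (integral_mul_left_eq_self (μ := μ) (fun U => tpow α (X U) i j) V).symm
      rw [h1]
      simp only [hVX, tpow_mul]
      exact (mul_integral_mul_apply hYint _ _ i j).symm
    rw [Commute, SemiconjBy]
    conv_lhs => rw [hinv]
    rw [Matrix.mul_assoc, ← tpow_mul, hVV, tpow_one, Matrix.mul_one]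
  obtain ⟨x, hx⟩ := exists_eq_sum_permMat hTV hN
  refine ⟨x, fun A => ?_, fun π => ?_⟩
  · have h := hlin (tpow α A)
    simp only [← tpow_mul, trace_tpow] at h
    rw [← h, hx, Finset.mul_sum, Matrix.trace_sum]
    refine Finset.sum_congr rfl fun σ _ => ?_
    rw [Matrix.mul_smul, Matrix.trace_smul, trace_tpow_mul_permMat, smul_eq_mul]
  · have h := hlin (permMat N π)
    have h2 : ∀ U, (permMat N π * tpow α (X U)).trace = permTrace B π := by
      intro U
      have hUU : ((U⁻¹ : Matrix.unitaryGroup (Fin N) ℂ) : Matrix (Fin N) (Fin N) ℂ) *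
          (U : Matrix (Fin N) (Fin N) ℂ) = 1 := by
        simp
      rw [hX]
      simp only
      rw [tpow_mul, tpow_mul, ← Matrix.mul_assoc, ← Matrix.mul_assoc,
        (commute_permMat_tpow π _).eq, Matrix.trace_mul_comm, Matrix.mul_assoc, ← Matrix.mul_assoc,
        ← tpow_mul, hUU, tpow_one, Matrix.one_mul, Matrix.trace_mul_comm, trace_tpow_mul_permMat]
    simp only [h2] at h
    rw [integral_const, probReal_univ, one_smul, hx, Finset.mul_sum, Matrix.trace_sum] at h
    rw [← h]
    refine Finset.sum_congr rfl fun σ _ => ?_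
    rw [Matrix.mul_smul, Matrix.trace_smul, permMat_mul, trace_permMat, smul_eq_mul]
    congr 1
    rw [← permTrace_conj _ (σ * π) π]
    congr 1
    group

end Moments

section Words

variable {α : Type*} [LinearOrder α]

/-- Words in transpositions `(s t)`, `s < t`, with weakly increasing larger letters, all letters
lying in `S`. -/
def MonoWord (S : Finset α) (L : List (α × α)) : Prop :=
  (∀ p ∈ L, p.1 < p.2 ∧ p.1 ∈ S ∧ p.2 ∈ S) ∧ L.Pairwise fun p q => p.2 ≤ q.2

/-- The product of the transpositions of a word. -/
def wprod (L : List (α × α)) : Equiv.Perm α := (L.map fun p => Equiv.swap p.1 p.2).prod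

theorem wprod_append (L L' : List (α × α)) : wprod (L ++ L') = wprod L * wprod L' := by
  simp [wprod]

theorem summable_pow_length {ι : Type*} [Fintype ι] {x : ℝ} (hx0 : 0 ≤ x)
    (hx : x * Fintype.card ι < 1) : Summable fun L : List ι => x ^ L.length := by
  rw [← List.equivSigmaTuple.symm.summable_iff]
  refine (summable_sigma_of_nonneg fun _ => pow_nonneg hx0 _).2 ⟨fun n =>
    (hasSum_fintype _).summable, ?_⟩
  have h : (fun n => ∑' f : Fin n → ι, x ^ (List.equivSigmaTuple.symm ⟨n, f⟩).length) =
      fun n => (x * Fintype.card ι) ^ n := by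
    funext n
    simp [List.equivSigmaTuple, mul_pow, mul_comm]
  rw [h]
  exact summable_geometric_of_lt_one (by positivity) hx

theorem summable_ite_pow_length {ι : Type*} [Fintype ι] {t : ℂ} (ht : ‖t‖ * Fintype.card ι < 1)
    (P : List ι → Prop) [DecidablePred P] :
    Summable fun L : List ι => if P L then t ^ L.length else 0 := by
  refine Summable.of_norm_bounded (summable_pow_length (norm_nonneg t) ht) fun L => ?_
  split_ifs
  · rw [norm_pow]
  · rw [norm_zero]; positivity

theorem monoWord_append_singleton {S : Finset α} {m s : α} (hm : ∀ x ∈ S, x < m) (hs : s ∈ S)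
    (L : List (α × α)) : MonoWord (insert m S) (L ++ [(s, m)]) ↔ MonoWord (insert m S) L := by
  constructor
  · rintro ⟨h1, h2⟩
    exact ⟨fun p hp => h1 p (by simp [hp]), (List.pairwise_append.1 h2).1⟩
  · rintro ⟨h1, h2⟩
    refine ⟨fun p hp => ?_, List.pairwise_append.2 ⟨h2, by simp, fun p hp q hq => ?_⟩⟩
    · rcases List.mem_append.1 hp with hp | hp
      · exact h1 p hp
      · simp only [List.mem_singleton] at hp
        subst hp
        simp [hm s hs, hs]
    · simp only [List.mem_singleton] at hq
      subst hq
      rcases Finset.mem_insert.1 (h1 p hp).2.2 with h | h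
      · exact h.le
      · exact (hm _ h).le

theorem monoWord_insert_iff {S : Finset α} {m : α} (hm : ∀ x ∈ S, x < m) (L : List (α × α)) :
    MonoWord (insert m S) L ↔ MonoWord S L ∨
      ∃ s ∈ S, ∃ L', MonoWord (insert m S) L' ∧ L = L' ++ [(s, m)] := by
  constructor
  · intro h
    rcases List.eq_nil_or_concat' L with rfl | ⟨L', p, rfl⟩
    · exact Or.inl ⟨by simp, by simp⟩
    obtain ⟨h1, h2⟩ := h
    have hp := h1 p (by simp)
    have hlt : ∀ x ∈ insert m S, x ≤ m := by
      intro x hx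
      rcases Finset.mem_insert.1 hx with h | h
      · exact h.le
      · exact (hm _ h).le
    by_cases hpm : p.2 = m
    · refine Or.inr ⟨p.1, ?_, L', ⟨fun q hq => h1 q (by simp [hq]), (List.pairwise_append.1 h2).1⟩,
        ?_⟩
      · rcases Finset.mem_insert.1 hp.2.1 with h | h
        · exact absurd hp.1 (by rw [h, hpm]; exact lt_irrefl _)
        · exact h
      · rw [← hpm]
    · refine Or.inl ⟨fun q hq => ?_, h2⟩
      have hq1 := h1 q hq
      have hq2 : q.2 < m := by
        have hpm' : p.2 < m := lt_of_le_of_ne (hlt _ hp.2.2) hpm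
        rcases List.mem_append.1 hq with h | h
        · exact ((List.pairwise_append.1 h2).2.2 q h p (by simp)).trans_lt hpm'
        · rw [List.mem_singleton.1 h]; exact hpm'
      exact ⟨hq1.1, (Finset.mem_insert.1 hq1.2.1).resolve_left (hq1.1.trans hq2).ne,
        (Finset.mem_insert.1 hq1.2.2).resolve_left hq2.ne⟩
  · rintro (h | ⟨s, hs, L', h, rfl⟩)
    · exact ⟨fun p hp => ⟨(h.1 p hp).1, Finset.mem_insert_of_mem (h.1 p hp).2.1,
        Finset.mem_insert_of_mem (h.1 p hp).2.2⟩, h.2⟩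
    · exact (monoWord_append_singleton hm hs L').2 h

variable [Fintype α]

open Classical in
/-- The generating function of monotone words in `S` with product `π`. -/
noncomputable def wgen (t : ℂ) (S : Finset α) (π : Equiv.Perm α) : ℂ :=
  ∑' L : List (α × α), if MonoWord S L ∧ wprod L = π then t ^ L.length else 0

theorem wgen_insert {t : ℂ} (ht : ‖t‖ * Fintype.card (α × α) < 1) {S : Finset α} {m : α}
    (hm : ∀ x ∈ S, x < m) (π : Equiv.Perm α) :
    wgen t (insert m S) π = wgen t S π +
      t * ∑ s ∈ S, wgen t (insert m S) (π * Equiv.swap s m) := by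
  classical
  have hlast : ∀ s ∈ S, t * wgen t (insert m S) (π * Equiv.swap s m) =
      ∑' L : List (α × α), if (MonoWord (insert m S) L ∧ wprod L = π) ∧
        L.getLast? = some (s, m) then t ^ L.length else 0 := by
    intro s hs
    have hinj : Function.Injective fun L : List (α × α) => L ++ [(s, m)] :=
      List.append_left_injective _
    symm
    rw [wgen, ← tsum_mul_left, ← hinj.tsum_eq]
    · refine tsum_congr fun L => ?_
      have h1 : wprod L * wprod [(s, m)] = π ↔ wprod L = π * Equiv.swap s m := by
        simp only [wprod, List.map_singleton, List.prod_singleton]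
        rw [← eq_mul_inv_iff_mul_eq, Equiv.swap_inv]
      simp [monoWord_append_singleton hm hs, wprod_append, h1, pow_succ', mul_ite]
    · intro L hL
      simp only [Function.mem_support, ne_eq, ite_eq_right_iff, not_forall] at hL
      obtain ⟨⟨-, hL⟩, -⟩ := hL
      obtain ⟨L', rfl⟩ := List.getLast?_eq_some_iff.1 hL
      exact ⟨L', rfl⟩
  rw [Finset.mul_sum, Finset.sum_congr rfl hlast, ← Summable.tsum_finsetSum
    fun s _ => summable_ite_pow_length ht _, wgen, wgen, ← Summable.tsum_add
    (summable_ite_pow_length ht _) (summable_sum fun s _ => summable_ite_pow_length ht _)]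
  refine tsum_congr fun L => ?_
  by_cases hπ : wprod L = π
  swap
  · simp [hπ]
  by_cases hL : MonoWord (insert m S) L
  · by_cases hS : MonoWord S L
    · have : ∀ s, L.getLast? ≠ some (s, m) := by
        intro s h
        obtain ⟨L', rfl⟩ := List.getLast?_eq_some_iff.1 h
        exact lt_irrefl m (hm m (hS.1 (s, m) (by simp)).2.2)
      simp [hπ, hL, hS, this]
    · obtain ⟨s, hs, L', -, rfl⟩ := ((monoWord_insert_iff hm L).1 hL).resolve_left hS
      rw [if_pos ⟨hL, hπ⟩, if_neg (by simp [hS]), zero_add, Finset.sum_eq_single s]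
      · rw [if_pos ⟨⟨hL, hπ⟩, by simp⟩]
      · intro s' _ hs'
        rw [if_neg]
        simp [hs'.symm]
      · exact fun h => absurd hs h
  · have hS : ¬ MonoWord S L := fun h => hL ((monoWord_insert_iff hm L).2 (Or.inl h))
    simp [hL, hS]

theorem wgen_empty (t : ℂ) (π : Equiv.Perm α) : wgen t ∅ π = if π = 1 then 1 else 0 := by
  classical
  rw [wgen, tsum_eq_single []]
  · simp [MonoWord, wprod, eq_comm]
  · rintro (_ | ⟨p, L⟩) hL
    · exact absurd rfl hL
    · rw [if_neg]
      rintro ⟨h, -⟩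
      simpa using (h.1 p (by simp)).2.1

end Words

section Gram

variable {α : Type*} [Fintype α] [DecidableEq α] {N : ℕ}

theorem permTrace_one_eq (π : Equiv.Perm α) :
    permTrace (1 : Matrix (Fin N) (Fin N) ℂ) π =
      ∑ i : α → Fin N, if ∀ k, i (π k) = i k then 1 else 0 := by
  refine Finset.sum_congr rfl fun i _ => ?_
  simp only [Matrix.one_apply, Fintype.prod_ite_zero, Finset.prod_const_one]
  simp only [eq_comm]

theorem permTrace_one_one :
    permTrace (1 : Matrix (Fin N) (Fin N) ℂ) (1 : Equiv.Perm α) = N ^ Fintype.card α := by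
  simp [permTrace_one_eq]

theorem permTrace_one_swap_mul {π : Equiv.Perm α} {s m : α} (hπ : π m = m) (hsm : s ≠ m) :
    permTrace (1 : Matrix (Fin N) (Fin N) ℂ) π =
      N * permTrace (1 : Matrix (Fin N) (Fin N) ℂ) (Equiv.swap s m * π) := by
  have h1 : ∀ i : α → Fin N, (∀ k, i ((Equiv.swap s m * π) k) = i k) ↔
      (∀ k, i (π k) = i k) ∧ i m = i s := by
    intro i
    have hsw : i m = i s → ∀ x, i (Equiv.swap s m x) = i x := by
      intro h x
      rw [Equiv.swap_apply_def]
      split_ifs with h1 h2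
      · rw [h, h1]
      · rw [← h, h2]
      · rfl
    constructor
    · intro h
      have hm : i m = i s := by
        have := h m
        rw [Equiv.Perm.mul_apply, hπ, Equiv.swap_apply_right] at this
        exact this.symm
      refine ⟨fun k => ?_, hm⟩
      rw [← h k, Equiv.Perm.mul_apply, hsw hm]
    · rintro ⟨h, hm⟩ k
      rw [Equiv.Perm.mul_apply, hsw hm, h]
  have h2 : ∀ (i : α → Fin N) (a : Fin N), (∀ k, Function.update i m a (π k) =
      Function.update i m a k) ↔ ∀ k, i (π k) = i k := by
    intro i a
    refine forall_congr' fun k => ?_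
    by_cases hk : k = m
    · rw [hk, hπ]; simp
    · have : π k ≠ m := fun h => hk (π.injective (h.trans hπ.symm))
      rw [Function.update_of_ne this, Function.update_of_ne hk]
  rw [permTrace_one_eq, permTrace_one_eq]
  simp only [h1]
  have h3 : ∀ i : α → Fin N, (if ∀ k, i (π k) = i k then (1 : ℂ) else 0) =
      ∑ a : Fin N, if (∀ k, i (π k) = i k) ∧ a = i s then (1 : ℂ) else 0 := by
    intro i
    by_cases h : ∀ k, i (π k) = i k <;> simp [h]
  have h4 : ∀ f : (α → Fin N) → ℂ, N * ∑ i, f i =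
      ∑ i : α → Fin N, ∑ a : Fin N, f (Function.update i m a) := by
    intro f
    have h5 : ∀ (a b : Fin N) (r : {j // j ≠ m} → Fin N), Function.update
        ((Equiv.funSplitAt m (Fin N)).symm (b, r)) m a =
          (Equiv.funSplitAt m (Fin N)).symm (a, r) := by
      intro a b r
      funext k
      by_cases hk : k = m
      · subst hk; simp [Equiv.funSplitAt, Equiv.piSplitAt]
      · simp [Equiv.funSplitAt, Equiv.piSplitAt, hk]
    rw [← (Equiv.funSplitAt m (Fin N)).symm.sum_comp,
      ← (Equiv.funSplitAt m (Fin N)).symm.sum_comp, Fintype.sum_prod_type, Fintype.sum_prod_type]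
    simp only [h5]
    rw [Finset.sum_const, Finset.card_univ, Fintype.card_fin, nsmul_eq_mul, Finset.sum_comm]
  rw [h4]
  refine Finset.sum_congr rfl fun i _ => (h3 i).trans (Finset.sum_congr rfl fun a _ => ?_)
  simp only [h2, Function.update_self, Function.update_of_ne hsm]

end Gram

section Inverse

variable {α : Type*} [LinearOrder α] [Fintype α] {N : ℕ}

/-- The permutations supported in `insert m S`, as products of a transposition `(s m)` and a
permutation supported in `S`. -/
theorem sum_support_subset_insert {S : Finset α} {m : α} (hm : m ∉ S)
    (f : Equiv.Perm α → ℂ) :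
    ∑ π : Equiv.Perm α with π.support ⊆ insert m S, f π =
      ∑ π : Equiv.Perm α with π.support ⊆ S, ∑ s ∈ insert m S, f (Equiv.swap s m * π) := by
  rw [← Finset.sum_product']
  symm
  refine Finset.sum_bij (fun x _ => Equiv.swap x.2 m * x.1) ?_ ?_ ?_ ?_
  · rintro ⟨π, s⟩ h
    simp only [Finset.mem_product, Finset.mem_filter, Finset.mem_univ, true_and] at h ⊢
    refine (Equiv.Perm.support_mul_le _ _).trans (Finset.union_subset ?_
      (h.1.trans (Finset.subset_insert _ _)))
    by_cases hs : s = m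
    · simp [hs]
    · rw [Equiv.Perm.support_swap hs]
      intro x hx
      rcases Finset.mem_insert.1 hx with rfl | hx
      · exact h.2
      · rw [Finset.mem_singleton.1 hx]; exact Finset.mem_insert_self _ _
  · rintro ⟨π, s⟩ h ⟨π', s'⟩ h' heq
    simp only [Finset.mem_product, Finset.mem_filter, Finset.mem_univ, true_and] at h h' heq
    have hπ : π m = m := Equiv.Perm.notMem_support.1 fun hh => hm (h.1 hh)
    have hπ' : π' m = m := Equiv.Perm.notMem_support.1 fun hh => hm (h'.1 hh)
    have h1 := congrArg (fun σ : Equiv.Perm α => σ m) heq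
    simp only [Equiv.Perm.mul_apply, hπ, hπ', Equiv.swap_apply_right] at h1
    subst h1
    rw [mul_left_cancel heq]
  · intro π h
    simp only [Finset.mem_filter, Finset.mem_univ, true_and] at h
    refine ⟨(Equiv.swap (π m) m * π, π m), ?_, by simp [← mul_assoc]⟩
    simp only [Finset.mem_product, Finset.mem_filter, Finset.mem_univ, true_and]
    refine ⟨fun x hx => ?_, ?_⟩
    · rw [Equiv.Perm.mem_support, Equiv.Perm.mul_apply] at hx
      by_contra hxS
      by_cases hxm : x = m
      · subst hxm; simp at hx
      · have hx2 : π x = x := Equiv.Perm.notMem_support.1 fun hh =>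
          (Finset.mem_insert.1 (h hh)).elim hxm hxS
        rw [hx2] at hx
        refine hx (Equiv.swap_apply_of_ne_of_ne (fun h => hxm ?_) hxm)
        exact π.injective (hx2.trans h)
    · by_cases h1 : π m = m
      · rw [h1]; exact Finset.mem_insert_self _ _
      · exact h (Equiv.Perm.apply_mem_support.2 (Equiv.Perm.mem_support.2 h1))
  · intros; rfl

theorem sum_wgen_mul_permTrace {N : ℕ} (hN0 : N ≠ 0)
    (hN : ‖-(N : ℂ)⁻¹‖ * Fintype.card (α × α) < 1) (S : Finset α) (κ : Equiv.Perm α) :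
    ∑ π : Equiv.Perm α with π.support ⊆ S, wgen (-(N : ℂ)⁻¹) S (κ * π⁻¹) *
      permTrace (1 : Matrix (Fin N) (Fin N) ℂ) π =
        if κ = 1 then (N : ℂ) ^ Fintype.card α else 0 := by
  induction S using Finset.induction_on_max generalizing κ with
  | empty =>
    rw [Finset.sum_eq_single (1 : Equiv.Perm α)]
    · rw [wgen_empty, permTrace_one_one]; simp
    · intro π hπ h1
      simp only [Finset.mem_filter, Finset.subset_empty, Equiv.Perm.support_eq_empty_iff] at hπ
      exact absurd hπ.2 h1
    · simp
  | insert m S hm ih =>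
    have hmS : m ∉ S := fun h => lt_irrefl _ (hm m h)
    rw [sum_support_subset_insert hmS, ← ih]
    refine Finset.sum_congr rfl fun π hπ => ?_
    have hπm : π m = m := Equiv.Perm.notMem_support.1 fun hh => hmS ((Finset.mem_filter.1 hπ).2 hh)
    rw [Finset.sum_insert hmS, Equiv.swap_self]
    have h1 : ∀ s ∈ S, wgen (-(N : ℂ)⁻¹) (insert m S) (κ * (Equiv.swap s m * π)⁻¹) *
        permTrace (1 : Matrix (Fin N) (Fin N) ℂ) (Equiv.swap s m * π) =
        (N : ℂ)⁻¹ * wgen (-(N : ℂ)⁻¹) (insert m S) (κ * π⁻¹ * Equiv.swap s m) *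
          permTrace (1 : Matrix (Fin N) (Fin N) ℂ) π := by
      intro s hs
      rw [permTrace_one_swap_mul hπm (hm s hs).ne, _root_.mul_inv_rev, Equiv.swap_inv,
        ← mul_assoc κ]
      have : (N : ℂ) ≠ 0 := by exact_mod_cast hN0
      field_simp
    rw [Finset.sum_congr rfl h1, ← Finset.sum_mul, ← Finset.mul_sum]
    have : (Equiv.refl α : Equiv.Perm α) * π = π := one_mul π
    rw [this, wgen_insert hN hm (κ * π⁻¹)]
    ring

end Inverse

section CycleFormula

variable {N : ℕ}

/-- The power sum of cycle type `ρ`, viewed as a permutation of `n` points. -/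
noncomputable def cyclePower {α : Type*} [Fintype α] [DecidableEq α]
    (A : Matrix (Fin N) (Fin N) ℂ) (n : ℕ) (ρ : Equiv.Perm α) : ℂ :=
  (ρ.cycleType.map fun k => (A ^ k).trace).prod * A.trace ^ (n - ρ.support.card)

theorem pow_succ_apply_eq_sum (A : Matrix (Fin N) (Fin N) ℂ) (n : ℕ) (a b : Fin N) :
    (A ^ (n + 1)) a b = ∑ i : Fin n → Fin N, ∏ k : Fin (n + 1),
      A ((Fin.cons a i : Fin (n + 1) → Fin N) k) ((Fin.snoc i b : Fin (n + 1) → Fin N) k) := by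
  induction n generalizing a with
  | zero => simp [Fin.snoc]
  | succ n ih =>
    rw [pow_succ', Matrix.mul_apply, ← (Fin.consEquiv fun _ => Fin N).sum_comp,
      Fintype.sum_prod_type]
    refine Finset.sum_congr rfl fun c _ => ?_
    rw [ih, Finset.mul_sum]
    refine Finset.sum_congr rfl fun i _ => ?_
    have h : (Fin.snoc ((Fin.consEquiv fun _ => Fin N) (c, i)) b : Fin (n + 2) → Fin N) =
        Fin.cons c (Fin.snoc i b : Fin (n + 1) → Fin N) :=
      (Fin.cons_snoc_eq_snoc_cons c i b).symm
    symm
    rw [h, Fin.prod_univ_succ]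
    rfl

theorem permTrace_finRotate (A : Matrix (Fin N) (Fin N) ℂ) (n : ℕ) :
    permTrace A (finRotate (n + 1)) = (A ^ (n + 1)).trace := by
  rw [permTrace, ← (Fin.consEquiv fun _ => Fin N).sum_comp, Fintype.sum_prod_type, Matrix.trace]
  refine Finset.sum_congr rfl fun a _ => ?_
  rw [Matrix.diag_apply, pow_succ_apply_eq_sum]
  refine Finset.sum_congr rfl fun i _ => Finset.prod_congr rfl fun k _ => ?_
  rw [Fin.snoc_eq_cons_rotate]
  rfl

theorem permMat_one {α : Type*} [Fintype α] : permMat N (1 : Equiv.Perm α) = 1 := by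
  ext i j
  simp [permMat, Matrix.one_apply]

variable {α β : Type*} [Fintype α] [DecidableEq α] [Fintype β] [DecidableEq β]

theorem permTrace_permCongr (A : Matrix (Fin N) (Fin N) ℂ) (e : α ≃ β) (ρ : Equiv.Perm α) :
    permTrace A (e.permCongr ρ) = permTrace A ρ := by
  rw [permTrace, permTrace, ← (e.arrowCongr (Equiv.refl (Fin N))).sum_comp]
  refine Finset.sum_congr rfl fun i _ => ?_
  rw [← e.prod_comp]
  simp

theorem permTrace_eq_mul (A : Matrix (Fin N) (Fin N) ℂ) (ρ : Equiv.Perm α) (p : α → Prop)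
    [DecidablePred p] (h : ∀ x, p (ρ x) ↔ p x) :
    permTrace A ρ = permTrace A (ρ.subtypePerm h) *
      permTrace A (ρ.subtypePerm (p := fun x => ¬ p x) fun x => not_congr (h x)) := by
  rw [permTrace, ← (Equiv.piEquivPiSubtypeProd p fun _ => Fin N).symm.sum_comp,
    Fintype.sum_prod_type, permTrace, permTrace, Finset.sum_mul_sum]
  refine Finset.sum_congr rfl fun i _ => Finset.sum_congr rfl fun j _ => ?_
  rw [← Fintype.prod_subtype_mul_prod_subtype p]
  congr 1
  · refine Finset.prod_congr rfl fun k _ => ?_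
    simp [Equiv.piEquivPiSubtypeProd, k.2, h]
  · refine Finset.prod_congr rfl fun k _ => ?_
    simp [Equiv.piEquivPiSubtypeProd, k.2, h]

theorem cycleType_eq_add (ρ : Equiv.Perm α) (p : α → Prop)
    [DecidablePred p] (h : ∀ x, p (ρ x) ↔ p x) :
    ρ.cycleType = (ρ.subtypePerm h).cycleType +
      (ρ.subtypePerm (p := fun x => ¬ p x) fun x => not_congr (h x)).cycleType := by
  have h1 : ρ = Equiv.Perm.ofSubtype (ρ.subtypePerm h) *
      Equiv.Perm.ofSubtype (ρ.subtypePerm (p := fun x => ¬ p x) fun x => not_congr (h x)) := by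
    ext x
    by_cases hx : p x
    · rw [Equiv.Perm.mul_apply, Equiv.Perm.ofSubtype_apply_of_not_mem
        (p := fun x => ¬ p x) _ (not_not.2 hx),
        Equiv.Perm.ofSubtype_apply_of_mem _ hx]
      rfl
    · rw [Equiv.Perm.mul_apply, Equiv.Perm.ofSubtype_apply_of_mem (p := fun x => ¬ p x) _ hx,
        Equiv.Perm.ofSubtype_apply_of_not_mem]
      · rfl
      · exact fun h' => hx ((h x).1 h')
  have h2 : Equiv.Perm.Disjoint (Equiv.Perm.ofSubtype (ρ.subtypePerm h))
      (Equiv.Perm.ofSubtype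
        (ρ.subtypePerm (p := fun x => ¬ p x) fun x => not_congr (h x))) := by
    intro x
    by_cases hx : p x
    · exact Or.inr (Equiv.Perm.ofSubtype_apply_of_not_mem (p := fun x => ¬ p x) _ (not_not.2 hx))
    · exact Or.inl (Equiv.Perm.ofSubtype_apply_of_not_mem _ hx)
  conv_lhs => rw [h1]
  rw [h2.cycleType_mul, Equiv.Perm.cycleType_ofSubtype, Equiv.Perm.cycleType_ofSubtype]

theorem cycleType_permCongr (e : α ≃ β) (ρ : Equiv.Perm α) :
    (e.permCongr ρ).cycleType = ρ.cycleType := by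
  have h : e.permCongr ρ = ρ.extendDomain
      (e.trans (Equiv.subtypeUnivEquiv (p := fun _ : β => True) fun _ => trivial).symm) := by
    ext y
    rw [Equiv.Perm.extendDomain_apply_subtype _ _ trivial]
    rfl
  rw [h, Equiv.Perm.cycleType_extendDomain]

theorem permTrace_eq_cyclePower (A : Matrix (Fin N) (Fin N) ℂ) (ρ : Equiv.Perm α) :
    permTrace A ρ = cyclePower A (Fintype.card α) ρ := by
  induction hn : Fintype.card α using Nat.strong_induction_on generalizing α with
  | _ n ih =>
  subst hn
  classical
  by_cases hρ : ρ = 1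
  · subst hρ
    rw [← trace_tpow_mul_permMat, permMat_one, Matrix.mul_one, trace_tpow]
    simp [cyclePower]
  obtain ⟨x, hx⟩ : ∃ x, ρ x ≠ x := by
    by_contra! h
    exact hρ (Equiv.ext h)
  by_cases hall : ∀ y, ρ.SameCycle x y
  · have hc : ρ.IsCycle := ⟨x, hx, fun y _ => hall y⟩
    have hsup : ρ.support = Finset.univ := by
      ext y
      simp only [Equiv.Perm.mem_support, Finset.mem_univ, iff_true]
      exact fun hy => hx (((hall y).apply_eq_self_iff).2 hy)
    obtain ⟨n, hn⟩ : ∃ n, Fintype.card α = n + 2 := by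
      have := hc.two_le_card_support
      rw [hsup, Finset.card_univ] at this
      exact ⟨_, (Nat.sub_add_cancel this).symm⟩
    have e : α ≃ Fin (n + 2) := Fintype.equivFinOfCardEq hn
    have hconj : IsConj (finRotate (n + 2)) (e.permCongr ρ) := by
      rw [Equiv.Perm.isConj_iff_cycleType_eq, cycleType_finRotate, cycleType_permCongr,
        hc.cycleType, hsup, Finset.card_univ, hn]
    obtain ⟨c, hc'⟩ := isConj_iff.1 hconj
    rw [← permTrace_permCongr A e, ← hc', permTrace_conj, permTrace_finRotate, cyclePower,
      hc.cycleType, hsup, Finset.card_univ, hn]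
    simp
  · push Not at hall
    obtain ⟨y, hy⟩ := hall
    have h : ∀ z, ρ.SameCycle x (ρ z) ↔ ρ.SameCycle x z := fun z =>
      Equiv.Perm.sameCycle_apply_right
    rw [permTrace_eq_mul A ρ _ h, ih _ (Fintype.card_subtype_lt hy) _ rfl,
      ih _ (Fintype.card_subtype_lt (not_not.2 (Equiv.Perm.SameCycle.refl ρ x))) _ rfl, cyclePower,
      cyclePower, cyclePower, cycleType_eq_add ρ _ h, Multiset.map_add, Multiset.prod_add,
      mul_mul_mul_comm, ← pow_add]
    congr 2
    have h1 := Fintype.card_subtype_compl fun z => ρ.SameCycle x z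
    have h2 := Fintype.card_subtype_le fun z => ρ.SameCycle x z
    have h3 := congrArg Multiset.sum (cycleType_eq_add ρ _ h)
    rw [Multiset.sum_add] at h3
    simp only [Equiv.Perm.sum_cycleType] at h3
    have h4 := Finset.card_le_univ (ρ.subtypePerm h).support
    have h5 := Finset.card_le_univ
      (ρ.subtypePerm (p := fun z => ¬ ρ.SameCycle x z) fun x => not_congr (h x)).support
    omega

end CycleFormula

section Moment

theorem cyclePower_ofSubtype {α : Type*} [Fintype α] [DecidableEq α] {N : ℕ}
    (A : Matrix (Fin N) (Fin N) ℂ) (n : ℕ) {S : Finset α}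
    (π : Equiv.Perm S) : cyclePower A n (Equiv.Perm.ofSubtype π) = cyclePower A n π := by
  rw [cyclePower, cyclePower, ← Equiv.Perm.sum_cycleType, ← Equiv.Perm.sum_cycleType,
    Equiv.Perm.cycleType_ofSubtype]

theorem cyclePower_add {α : Type*} [Fintype α] [DecidableEq α] {N : ℕ}
    (A : Matrix (Fin N) (Fin N) ℂ) {n : ℕ} (k : ℕ)
    {π : Equiv.Perm α} (hn : π.support.card ≤ n) :
    cyclePower A (n + k) π = cyclePower A n π * A.trace ^ k := by
  rw [cyclePower, cyclePower, mul_assoc, ← pow_add]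
  congr 2
  omega

theorem sum_support_subset_eq {α R : Type*} [Fintype α] [DecidableEq α] [AddCommMonoid R]
    (S : Finset α) (f : Equiv.Perm α → R) :
    ∑ π : Equiv.Perm α with π.support ⊆ S, f π =
      ∑ π : Equiv.Perm S, f (Equiv.Perm.ofSubtype π) := by
  symm
  refine Finset.sum_bij (fun π _ => Equiv.Perm.ofSubtype π) ?_ ?_ ?_ fun _ _ => rfl
  · intro π _
    simp only [Finset.mem_filter, Finset.mem_univ, true_and]
    intro x hx
    by_contra h
    exact Equiv.Perm.mem_support.1 hx (Equiv.Perm.ofSubtype_apply_of_not_mem π h)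
  · intro π _ π' _ h
    exact Equiv.Perm.ofSubtype_injective h
  · intro π hπ
    simp only [Finset.mem_filter, Finset.mem_univ, true_and] at hπ
    have h2 : ∀ x, π x ≠ x → x ∈ S := fun x hx => hπ (Equiv.Perm.mem_support.2 hx)
    have h1 : ∀ x, π x ∈ S ↔ x ∈ S := fun x => by
      by_cases hx : π x = x
      · rw [hx]
      · exact iff_of_true (h2 _ fun h => hx (π.injective h)) (h2 _ hx)
    exact ⟨π.subtypePerm h1, Finset.mem_univ _, Equiv.Perm.ofSubtype_subtypePerm h1 h2⟩

variable {α : Type*} [LinearOrder α] [Fintype α] {N : ℕ}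

theorem sum_wgen_mul_permTrace_subtype (hN0 : N ≠ 0)
    (hN : ‖-(N : ℂ)⁻¹‖ * Fintype.card (α × α) < 1) (S : Finset α) (κ : Equiv.Perm S) :
    ∑ π : Equiv.Perm S, wgen (-(N : ℂ)⁻¹) S (Equiv.Perm.ofSubtype (κ * π⁻¹)) *
      permTrace (1 : Matrix (Fin N) (Fin N) ℂ) π = if κ = 1 then (N : ℂ) ^ S.card else 0 := by
  have hN1 : (N : ℂ) ≠ 0 := by exact_mod_cast hN0
  have h := sum_wgen_mul_permTrace hN0 hN S (Equiv.Perm.ofSubtype κ)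
  rw [sum_support_subset_eq] at h
  obtain ⟨k, hk⟩ := Nat.exists_eq_add_of_le (Finset.card_le_univ S)
  have h1 : ∀ π : Equiv.Perm S, permTrace (1 : Matrix (Fin N) (Fin N) ℂ)
      (Equiv.Perm.ofSubtype π) = permTrace (1 : Matrix (Fin N) (Fin N) ℂ) π * N ^ k := by
    intro π
    rw [permTrace_eq_cyclePower, permTrace_eq_cyclePower, hk,
      Fintype.card_coe, cyclePower_add, cyclePower_ofSubtype, Matrix.trace_one, Fintype.card_fin]
    rw [← Equiv.Perm.sum_cycleType, Equiv.Perm.cycleType_ofSubtype, Equiv.Perm.sum_cycleType,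
      ← Fintype.card_coe S]
    exact Finset.card_le_univ _
  have h2 : (Equiv.Perm.ofSubtype κ = 1) ↔ κ = 1 :=
    map_eq_one_iff _ Equiv.Perm.ofSubtype_injective
  simp only [h1, h2, ← mul_assoc, ← Finset.sum_mul] at h
  rw [← mul_left_inj' (pow_ne_zero k hN1)]
  simp only [map_mul, map_inv]
  rw [h, ite_mul, zero_mul, ← pow_add, ← hk]

/-- Moments of the trace over the unitary group as a weighted sum over monotone
factorizations. -/
theorem integral_trace_pow_eq_sum (μ : Measure (Matrix.unitaryGroup (Fin N) ℂ))
    [μ.IsHaarMeasure] [IsProbabilityMeasure μ] (A B : Matrix (Fin N) (Fin N) ℂ) (hN0 : N ≠ 0)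
    (hN : ‖-(N : ℂ)⁻¹‖ * Fintype.card (α × α) < 1) (S : Finset α) (hS : S.card ≤ N) :
    (N : ℂ) ^ S.card * ∫ U : Matrix.unitaryGroup (Fin N) ℂ,
        (A * ((U : Matrix (Fin N) (Fin N) ℂ) * B *
          ((U⁻¹ : Matrix.unitaryGroup (Fin N) ℂ) : Matrix (Fin N) (Fin N) ℂ))).trace ^ S.card ∂μ =
      ∑ ρ : Equiv.Perm α with ρ.support ⊆ S, ∑ σ : Equiv.Perm α with σ.support ⊆ S,
        cyclePower A S.card ρ * cyclePower B S.card σ * wgen (-(N : ℂ)⁻¹) S (ρ * σ)⁻¹ := by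
  obtain ⟨x, hx1, hx2⟩ := exists_integral_trace_pow_eq (α := S) μ B (by rwa [Fintype.card_coe])
  have hx3 : ∀ κ : Equiv.Perm S, (N : ℂ) ^ S.card * x κ =
      ∑ π : Equiv.Perm S, permTrace B π *
        wgen (-(N : ℂ)⁻¹) S (Equiv.Perm.ofSubtype (π * κ)⁻¹) := by
    intro κ
    simp only [hx2, Finset.sum_mul]
    rw [Finset.sum_comm]
    have h1 : ∀ σ : Equiv.Perm S, ∑ π : Equiv.Perm S, x σ *
        permTrace (1 : Matrix (Fin N) (Fin N) ℂ) (π * σ) *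
          wgen (-(N : ℂ)⁻¹) S (Equiv.Perm.ofSubtype (π * κ)⁻¹) =
        if σ = κ then (N : ℂ) ^ S.card * x κ else 0 := by
      intro σ
      have h2 := sum_wgen_mul_permTrace_subtype hN0 hN S (κ⁻¹ * σ)
      rw [← Equiv.sum_comp (Equiv.mulRight σ)] at h2
      have h3 : κ⁻¹ * σ = 1 ↔ σ = κ := by rw [inv_mul_eq_one, eq_comm]
      rw [← mul_one (x σ)]
      simp only [mul_assoc (x σ)]
      rw [← Finset.mul_sum]
      simp only [one_mul]
      trans x σ * if κ⁻¹ * σ = 1 then (N : ℂ) ^ S.card else 0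
      · rw [← h2]
        congr 1
        refine Finset.sum_congr rfl fun π _ => ?_
        rw [mul_comm]
        congr 3
        simp only [Equiv.coe_mulRight]
        group
      · simp only [h3]
        split_ifs with h
        · rw [h, mul_comm]
        · rw [mul_zero]
    rw [Finset.sum_congr rfl fun σ _ => h1 σ]
    simp
  have hA := hx1 A
  rw [Fintype.card_coe] at hA
  rw [hA, Finset.mul_sum, sum_support_subset_eq]
  refine Finset.sum_congr rfl fun ρ _ => ?_
  rw [sum_support_subset_eq, ← mul_assoc, hx3, Finset.sum_mul,
    ← Equiv.sum_comp (MulAut.conj ρ).toEquiv]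
  refine Finset.sum_congr rfl fun σ _ => ?_
  have h4 : (MulAut.conj ρ).toEquiv σ = ρ * σ * ρ⁻¹ := rfl
  rw [h4, permTrace_conj, inv_mul_cancel_right, permTrace_eq_cyclePower, permTrace_eq_cyclePower,
    Fintype.card_coe, cyclePower_ofSubtype, cyclePower_ofSubtype, ← map_mul, ← map_inv]
  ring

end Moment

section Merge

variable {α : Type*} [LinearOrder α]

/-- The stable merge of two words with respect to the larger letters. -/
def wmerge (L L' : List (α × α)) : List (α × α) :=
  (L ++ L').mergeSort fun p q => decide (p.2 ≤ q.2)

theorem wmerge_perm (L L' : List (α × α)) : (wmerge L L').Perm (L ++ L') :=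
  List.mergeSort_perm _ _

theorem pairwise_wmerge (L L' : List (α × α)) :
    (wmerge L L').Pairwise fun p q => p.2 ≤ q.2 := by
  have h := List.pairwise_mergeSort (le := fun p q : α × α => decide (p.2 ≤ q.2))
    (fun a b c h h' => by simp only [decide_eq_true_eq] at *; exact h.trans h')
    (fun a b => by simpa using le_total a.2 b.2) (L ++ L')
  simpa [wmerge] using h

theorem sublist_wmerge {K L L' : List (α × α)} (hK : K.Pairwise fun p q => p.2 ≤ q.2)
    (h : K.Sublist (L ++ L')) : K.Sublist (wmerge L L') :=
  List.sublist_mergeSort (fun a b c h h' => by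
    simp only [decide_eq_true_eq] at *; exact h.trans h')
    (fun a b => by simpa using le_total a.2 b.2) (by simpa using hK) h

theorem filter_wmerge_left {L L' : List (α × α)} (f : α → Bool) (h : ∀ p ∈ L, f p.2)
    (h' : ∀ p ∈ L', ¬ f p.2) (hL : L.Pairwise fun p q => p.2 ≤ q.2) :
    (wmerge L L').filter (fun p => f p.2) = L := by
  have h1 : L.filter (fun p => f p.2) = L := List.filter_eq_self.2 h
  have h2 : L'.filter (fun p => f p.2) = [] := List.filter_eq_nil_iff.2 h'
  have h3 := (sublist_wmerge hL (List.sublist_append_left L L')).filter fun p => f p.2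
  rw [h1] at h3
  refine (h3.eq_of_length ?_).symm
  rw [((wmerge_perm L L').filter _).length_eq, List.filter_append, h1, h2, List.append_nil]

theorem filter_wmerge_right {L L' : List (α × α)} (f : α → Bool) (h : ∀ p ∈ L, f p.2)
    (h' : ∀ p ∈ L', ¬ f p.2) (hL : L'.Pairwise fun p q => p.2 ≤ q.2) :
    (wmerge L L').filter (fun p => !f p.2) = L' := by
  have h1 : L'.filter (fun p => !f p.2) = L' := List.filter_eq_self.2 (by simpa using h')
  have h2 : L.filter (fun p => !f p.2) = [] := List.filter_eq_nil_iff.2 (by simpa using h)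
  have h3 := (sublist_wmerge hL (List.sublist_append_right L L')).filter fun p => !f p.2
  rw [h1] at h3
  refine (h3.eq_of_length ?_).symm
  rw [((wmerge_perm L L').filter _).length_eq, List.filter_append, h1, h2, List.nil_append]

theorem eq_of_filter_eq (f : α → Bool) {L L' : List (α × α)}
    (hL : L.Pairwise fun p q => p.2 ≤ q.2) (hL' : L'.Pairwise fun p q => p.2 ≤ q.2)
    (h : L.filter (fun p => f p.2) = L'.filter fun p => f p.2)
    (h' : L.filter (fun p => !f p.2) = L'.filter fun p => !f p.2) : L = L' := by
  have hmem : ∀ {K K' : List (α × α)}, K.filter (fun p => f p.2) = K'.filter (fun p => f p.2) →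
      K.filter (fun p => !f p.2) = K'.filter (fun p => !f p.2) → ∀ p ∈ K, p ∈ K' := by
    intro K K' h h' p hp
    by_cases hf : f p.2
    · exact (List.mem_filter.1 (h ▸ List.mem_filter.2 ⟨hp, hf⟩)).1
    · exact (List.mem_filter.1 (h' ▸ List.mem_filter.2 ⟨hp, by simpa using hf⟩)).1
  induction L generalizing L' with
  | nil =>
    cases L' with
    | nil => rfl
    | cons q L' => exact absurd (hmem h.symm h'.symm q (by simp)) (by simp)
  | cons p L ih =>
    cases L' with
    | nil => exact absurd (hmem h h' p (by simp)) (by simp)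
    | cons q L' =>
      have hpq : p.2 = q.2 := by
        have h1 := hmem h h' p (by simp)
        have h2 := hmem h.symm h'.symm q (by simp)
        rw [List.pairwise_cons] at hL hL'
        rcases List.mem_cons.1 h1 with rfl | h1
        · rfl
        rcases List.mem_cons.1 h2 with rfl | h2
        · rfl
        exact le_antisymm (hL.1 q h2) (hL'.1 p h1)
      by_cases hf : f p.2
      · have hq : f q.2 := hpq ▸ hf
        simp only [List.filter_cons, hf, hq, if_true, Bool.not_true, Bool.false_eq_true, if_false,
          List.cons.injEq] at h h'
        rw [h.1, ih hL.of_cons hL'.of_cons h.2 h']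
      · have hq : ¬ f q.2 := hpq ▸ hf
        simp only [List.filter_cons, hf, hq, Bool.not_false, if_true, Bool.false_eq_true, if_false,
          List.cons.injEq] at h h'
        rw [h'.1, ih hL.of_cons hL'.of_cons h h'.2]

variable [Fintype α]

theorem support_wprod_subset {S : Finset α} {L : List (α × α)}
    (h : ∀ p ∈ L, p.1 ∈ S ∧ p.2 ∈ S) : (wprod L).support ⊆ S := by
  induction L with
  | nil => simp [wprod]
  | cons p L ih =>
    have h1 : wprod (p :: L) = Equiv.swap p.1 p.2 * wprod L := by simp [wprod]
    rw [h1]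
    refine (Equiv.Perm.support_mul_le _ _).trans (Finset.union_subset ?_
      (ih fun q hq => h q (by simp [hq])))
    intro x hx
    by_contra hxS
    have hp := h p (by simp)
    refine Equiv.Perm.mem_support.1 hx (Equiv.swap_apply_of_ne_of_ne ?_ ?_)
    · rintro rfl; exact hxS hp.1
    · rintro rfl; exact hxS hp.2

theorem disjoint_of_support_subset {S T : Finset α} (hST : Disjoint S T) {f g : Equiv.Perm α}
    (hf : f.support ⊆ S) (hg : g.support ⊆ T) : f.Disjoint g :=
  Equiv.Perm.disjoint_iff_disjoint_support.2 (Finset.disjoint_of_subset_left hf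
    (Finset.disjoint_of_subset_right hg hST))

theorem wprod_eq_mul_filter {S T : Finset α} (hST : Disjoint S T) {L : List (α × α)}
    (h : ∀ p ∈ L, (p.1 ∈ S ∧ p.2 ∈ S) ∨ (p.1 ∈ T ∧ p.2 ∈ T)) :
    wprod L = wprod (L.filter fun p => decide (p.2 ∈ S)) *
      wprod (L.filter fun p => !decide (p.2 ∈ S)) := by
  induction L with
  | nil => simp [wprod]
  | cons p L ih =>
    have hc : ∀ q : α × α, ∀ K, wprod (q :: K) = Equiv.swap q.1 q.2 * wprod K := fun q K => by
      simp [wprod]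
    have ih := ih fun q hq => h q (by simp [hq])
    rcases h p (by simp) with hp | hp
    · simp only [List.filter_cons, hp.2, decide_true, if_true, Bool.not_true, Bool.false_eq_true,
        if_false]
      rw [hc, hc, mul_assoc, ← ih]
    · have hpS : p.2 ∉ S := Finset.disjoint_right.1 hST hp.2
      simp only [List.filter_cons, hpS, decide_false, Bool.not_false, if_true, Bool.false_eq_true,
        if_false]
      rw [hc, hc, ih, ← mul_assoc, ← mul_assoc]
      congr 1
      have h1 : (wprod (L.filter fun p => decide (p.2 ∈ S))).support ⊆ S := by
        refine support_wprod_subset fun q hq => ?_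
        rw [List.mem_filter, decide_eq_true_eq] at hq
        exact (h q (by simp [hq.1])).resolve_right fun h' =>
          Finset.disjoint_left.1 hST hq.2 h'.2
      have h2 : (Equiv.swap p.1 p.2).support ⊆ T := by
        have := support_wprod_subset (L := [p]) (S := T) (by simpa using hp)
        simpa [wprod] using this
      exact (disjoint_of_support_subset hST h1 h2).commute.eq.symm

theorem wprod_wmerge {S T : Finset α} (hST : Disjoint S T) {L L' : List (α × α)}
    (h : MonoWord S L) (h' : MonoWord T L') : wprod (wmerge L L') = wprod L * wprod L' := by
  have hS : ∀ p ∈ L, decide (p.2 ∈ S) = true := fun p hp => by simpa using (h.1 p hp).2.2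
  have hT : ∀ p ∈ L', ¬ decide (p.2 ∈ S) = true := fun p hp => by
    simpa using Finset.disjoint_right.1 hST (h'.1 p hp).2.2
  rw [wprod_eq_mul_filter hST, filter_wmerge_left (fun x => decide (x ∈ S)) hS hT h.2,
    filter_wmerge_right (fun x => decide (x ∈ S)) hS hT h'.2]
  intro p hp
  rcases List.mem_append.1 ((wmerge_perm L L').mem_iff.1 hp) with hp | hp
  · exact Or.inl (h.1 p hp).2
  · exact Or.inr (h'.1 p hp).2

end Merge

section Factorizations

variable {α : Type*} [LinearOrder α] [Fintype α]

/-- Two permutations and a monotone word in `S` with product the identity. -/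
def IsFact (S : Finset α) (x : Equiv.Perm α × Equiv.Perm α × List (α × α)) : Prop :=
  x.1.support ⊆ S ∧ x.2.1.support ⊆ S ∧ MonoWord S x.2.2 ∧ x.1 * x.2.1 * wprod x.2.2 = 1

/-- The elementary moves of a factorization. -/
def FactStep (x : Equiv.Perm α × Equiv.Perm α × List (α × α)) (a b : α) : Prop :=
  b = x.1 a ∨ b = x.2.1 a ∨ (a, b) ∈ x.2.2

/-- Transitivity of a factorization on `S`. -/
def FactTransitive (S : Finset α) (x : Equiv.Perm α × Equiv.Perm α × List (α × α)) : Prop :=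
  ∀ a ∈ S, ∀ b ∈ S, Relation.EqvGen (FactStep x) a b

open Classical in
/-- The orbit of `m`. -/
noncomputable def factOrbit (x : Equiv.Perm α × Equiv.Perm α × List (α × α)) (m : α) : Finset α :=
  Finset.univ.filter fun a => Relation.EqvGen (FactStep x) m a

/-- The product of factorizations with disjoint supports. -/
def factMerge (y z : Equiv.Perm α × Equiv.Perm α × List (α × α)) :
    Equiv.Perm α × Equiv.Perm α × List (α × α) :=
  (y.1 * z.1, y.2.1 * z.2.1, wmerge y.2.2 z.2.2)

theorem mem_iff_of_eqvGen {α : Type*} {r : α → α → Prop} {T : Finset α}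
    (h : ∀ a b, r a b → (a ∈ T ↔ b ∈ T)) {a b : α} (hab : Relation.EqvGen r a b) :
    a ∈ T ↔ b ∈ T := by
  induction hab with
  | rel a b h' => exact h a b h'
  | refl => rfl
  | symm _ _ _ ih => exact ih.symm
  | trans _ _ _ _ _ ih ih' => exact ih.trans ih'

theorem apply_mem_iff_of_support_subset {ρ : Equiv.Perm α} {S : Finset α} (h : ρ.support ⊆ S)
    (a : α) : ρ a ∈ S ↔ a ∈ S := by
  by_cases ha : ρ a = a
  · rw [ha]
  · exact iff_of_true (h (Equiv.Perm.mem_support.2 fun h' => ha (ρ.injective h')))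
      (h (Equiv.Perm.mem_support.2 ha))

theorem IsFact.mem_iff_of_step {S : Finset α} {x : Equiv.Perm α × Equiv.Perm α × List (α × α)}
    (hx : IsFact S x) {a b : α} (h : FactStep x a b) : a ∈ S ↔ b ∈ S := by
  rcases h with rfl | rfl | h
  · exact (apply_mem_iff_of_support_subset hx.1 a).symm
  · exact (apply_mem_iff_of_support_subset hx.2.1 a).symm
  · have := hx.2.2.1.1 _ h
    exact iff_of_true this.2.1 this.2.2

theorem mul_apply_of_mem {S T : Finset α} (hST : Disjoint S T) {ρ ρ' : Equiv.Perm α}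
    (h' : ρ'.support ⊆ T) {a : α} (ha : a ∈ S) : (ρ * ρ') a = ρ a := by
  rw [Equiv.Perm.mul_apply,
    Equiv.Perm.notMem_support.1 fun h => Finset.disjoint_left.1 hST ha (h' h)]

theorem eq_of_mul_eq_of_support {S T : Finset α} (hST : Disjoint S T) {ρ ρ' τ τ' : Equiv.Perm α}
    (h : ρ.support ⊆ S) (h' : ρ'.support ⊆ T) (hτ : τ.support ⊆ S) (hτ' : τ'.support ⊆ T)
    (heq : ρ * ρ' = τ * τ') : ρ = τ ∧ ρ' = τ' := by
  have h1 : ρ = τ := by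
    ext a
    by_cases ha : a ∈ S
    · exact (mul_apply_of_mem hST h' ha).symm.trans
        ((DFunLike.congr_fun heq a).trans (mul_apply_of_mem hST hτ' ha))
    · rw [Equiv.Perm.notMem_support.1 fun h1 => ha (h h1),
        Equiv.Perm.notMem_support.1 fun h1 => ha (hτ h1)]
  subst h1
  exact ⟨rfl, mul_left_cancel heq⟩

theorem exists_eq_mul_of_preserves {S T : Finset α} {ρ : Equiv.Perm α}
    (h : ρ.support ⊆ S) (hT : ∀ a, ρ a ∈ T ↔ a ∈ T) :
    ∃ ρ₀ ρ₁ : Equiv.Perm α, ρ₀.support ⊆ T ∧ ρ₁.support ⊆ S \ T ∧ ρ = ρ₀ * ρ₁ := by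
  set ρ₀ : Equiv.Perm α := Equiv.Perm.ofSubtype (ρ.subtypePerm hT) with hρ₀
  have h0 : ∀ a ∈ T, ρ₀ a = ρ a := fun a ha => by
    rw [hρ₀, Equiv.Perm.ofSubtype_apply_of_mem _ ha]; rfl
  have h1 : ∀ a ∉ T, ρ₀ a = a := fun a ha => Equiv.Perm.ofSubtype_apply_of_not_mem _ ha
  refine ⟨ρ₀, ρ₀⁻¹ * ρ, fun a ha => ?_, fun a ha => ?_, (mul_inv_cancel_left _ _).symm⟩
  · by_contra haT
    exact Equiv.Perm.mem_support.1 ha (h1 a haT)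
  · have haT : a ∉ T := fun haT => Equiv.Perm.mem_support.1 ha (by
      rw [Equiv.Perm.mul_apply, ← h0 a haT, Equiv.Perm.inv_eq_iff_eq])
    refine Finset.mem_sdiff.2 ⟨h (Equiv.Perm.mem_support.2 fun hρ => ?_), haT⟩
    refine Equiv.Perm.mem_support.1 ha ?_
    rw [Equiv.Perm.mul_apply, hρ, Equiv.Perm.inv_eq_iff_eq, h1 a haT]

theorem isFact_factMerge_iff {S T : Finset α} (hST : Disjoint S T)
    {y z : Equiv.Perm α × Equiv.Perm α × List (α × α)} (hy1 : y.1.support ⊆ S)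
    (hy2 : y.2.1.support ⊆ S) (hy3 : MonoWord S y.2.2) (hz1 : z.1.support ⊆ T)
    (hz2 : z.2.1.support ⊆ T) (hz3 : MonoWord T z.2.2) :
    IsFact (S ∪ T) (factMerge y z) ↔ IsFact S y ∧ IsFact T z := by
  have hmono : MonoWord (S ∪ T) (wmerge y.2.2 z.2.2) := by
    refine ⟨fun p hp => ?_, pairwise_wmerge _ _⟩
    rcases List.mem_append.1 ((wmerge_perm _ _).mem_iff.1 hp) with hp | hp
    · have := hy3.1 p hp
      exact ⟨this.1, Finset.mem_union_left _ this.2.1, Finset.mem_union_left _ this.2.2⟩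
    · have := hz3.1 p hp
      exact ⟨this.1, Finset.mem_union_right _ this.2.1, Finset.mem_union_right _ this.2.2⟩
  have hwy := support_wprod_subset fun p hp => (hy3.1 p hp).2
  have hwz := support_wprod_subset fun p hp => (hz3.1 p hp).2
  have hmul : ∀ {f g : Equiv.Perm α} {U : Finset α}, f.support ⊆ U → g.support ⊆ U →
      (f * g).support ⊆ U := fun hf hg =>
    (Equiv.Perm.support_mul_le _ _).trans (Finset.union_subset hf hg)
  have hprod : y.1 * z.1 * (y.2.1 * z.2.1) * wprod (wmerge y.2.2 z.2.2) =
      (y.1 * y.2.1 * wprod y.2.2) * (z.1 * z.2.1 * wprod z.2.2) := by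
    rw [wprod_wmerge hST hy3 hz3,
      (disjoint_of_support_subset hST hy2 hz1).commute.symm.mul_mul_mul_comm,
      (disjoint_of_support_subset hST hwy (hmul hz1 hz2)).commute.symm.mul_mul_mul_comm]
  have hdis := disjoint_of_support_subset hST (hmul (hmul hy1 hy2) hwy) (hmul (hmul hz1 hz2) hwz)
  have h1 : (y.1 * z.1).support ⊆ S ∪ T := hmul (hy1.trans Finset.subset_union_left)
    (hz1.trans Finset.subset_union_right)
  have h2 : (y.2.1 * z.2.1).support ⊆ S ∪ T := hmul (hy2.trans Finset.subset_union_left)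
    (hz2.trans Finset.subset_union_right)
  simp only [IsFact, factMerge, hprod, hdis.mul_eq_one_iff, hy1, hy2, hy3, hz1, hz2, hz3, hmono,
    h1, h2, true_and]

theorem factStep_factMerge_iff {S T : Finset α} (hST : Disjoint S T)
    {y z : Equiv.Perm α × Equiv.Perm α × List (α × α)} (hz1 : z.1.support ⊆ T)
    (hz2 : z.2.1.support ⊆ T) (hz3 : MonoWord T z.2.2) {a b : α} (ha : a ∈ S) :
    FactStep (factMerge y z) a b ↔ FactStep y a b := by
  have h : (a, b) ∉ z.2.2 := fun h => Finset.disjoint_left.1 hST ha (hz3.1 _ h).2.1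
  simp only [FactStep, factMerge, mul_apply_of_mem hST hz1 ha, mul_apply_of_mem hST hz2 ha,
    (wmerge_perm _ _).mem_iff, List.mem_append, h, or_false]

theorem mul_apply_mem_iff {S T : Finset α} (hST : Disjoint S T) {ρ ρ' : Equiv.Perm α}
    (h : ρ.support ⊆ S) (h' : ρ'.support ⊆ T) (a : α) : (ρ * ρ') a ∈ S ↔ a ∈ S := by
  have h1 := apply_mem_iff_of_support_subset (h'.trans hST.symm.le_compl_right) a
  rw [Equiv.Perm.mul_apply, apply_mem_iff_of_support_subset h]
  simpa [not_iff_not] using h1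

theorem mem_iff_of_factStep_factMerge {S T : Finset α} (hST : Disjoint S T)
    {y z : Equiv.Perm α × Equiv.Perm α × List (α × α)} (hy : IsFact S y) (hz : IsFact T z)
    {a b : α} (h : FactStep (factMerge y z) a b) : a ∈ S ↔ b ∈ S := by
  rcases h with rfl | rfl | h
  · exact (mul_apply_mem_iff hST hy.1 hz.1 a).symm
  · exact (mul_apply_mem_iff hST hy.2.1 hz.2.1 a).symm
  · rcases List.mem_append.1 ((wmerge_perm _ _).mem_iff.1 h) with h | h
    · have := hy.2.2.1.1 _ h
      exact iff_of_true this.2.1 this.2.2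
    · have := hz.2.2.1.1 _ h
      exact iff_of_false (Finset.disjoint_right.1 hST this.2.1)
        (Finset.disjoint_right.1 hST this.2.2)

theorem eqvGen_of_preserves {α : Type*} {r r' : α → α → Prop} {T : Finset α}
    (h : ∀ a b, r a b → (a ∈ T ↔ b ∈ T)) (h' : ∀ a ∈ T, ∀ b, r a b → r' a b)
    {a b : α} (hab : Relation.EqvGen r a b) (ha : a ∈ T) : Relation.EqvGen r' a b := by
  induction hab with
  | rel a b hr => exact .rel _ _ (h' a ha b hr)
  | refl => exact .refl _
  | symm _ _ h1 ih => exact (ih ((mem_iff_of_eqvGen h h1).2 ha)).symm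
  | trans _ _ _ h1 _ ih ih' => exact (ih ha).trans _ _ _ (ih' ((mem_iff_of_eqvGen h h1).1 ha))

theorem mem_factOrbit {α : Type*} [Fintype α]
    {x : Equiv.Perm α × Equiv.Perm α × List (α × α)} {m a : α} :
    a ∈ factOrbit x m ↔ Relation.EqvGen (FactStep x) m a := by
  simp [factOrbit]

theorem IsFact.factOrbit_subset {S : Finset α} {x : Equiv.Perm α × Equiv.Perm α × List (α × α)}
    (hx : IsFact S x) {m : α} (hm : m ∈ S) : factOrbit x m ⊆ S := fun _ ha =>
  (mem_iff_of_eqvGen (fun _ _ => hx.mem_iff_of_step) (mem_factOrbit.1 ha)).1 hm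

theorem factOrbit_factMerge {S T : Finset α} (hST : Disjoint S T)
    {y z : Equiv.Perm α × Equiv.Perm α × List (α × α)} (hy : IsFact S y)
    (hyt : FactTransitive S y) (hz : IsFact T z) {m : α} (hm : m ∈ S) :
    factOrbit (factMerge y z) m = S := by
  ext a
  rw [mem_factOrbit]
  refine ⟨fun h => (mem_iff_of_eqvGen
    (fun _ _ => mem_iff_of_factStep_factMerge hST hy hz) h).1 hm, fun ha => ?_⟩
  exact eqvGen_of_preserves (T := S) (fun _ _ => hy.mem_iff_of_step)
    (fun a ha b hab => (factStep_factMerge_iff hST hz.1 hz.2.1 hz.2.2.1 ha).2 hab)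
    (hyt m hm a ha) hm

theorem factMerge_injective {S T : Finset α} (hST : Disjoint S T)
    {y z y' z' : Equiv.Perm α × Equiv.Perm α × List (α × α)} (hy : IsFact S y) (hz : IsFact T z)
    (hy' : IsFact S y') (hz' : IsFact T z') (h : factMerge y z = factMerge y' z') :
    y = y' ∧ z = z' := by
  simp only [factMerge, Prod.mk.injEq] at h
  have h1 := eq_of_mul_eq_of_support hST hy.1 hz.1 hy'.1 hz'.1 h.1
  have h2 := eq_of_mul_eq_of_support hST hy.2.1 hz.2.1 hy'.2.1 hz'.2.1 h.2.1
  have hS : ∀ {x : Equiv.Perm α × Equiv.Perm α × List (α × α)}, IsFact S x →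
      ∀ p ∈ x.2.2, decide (p.2 ∈ S) = true := fun hx p hp => by
    simpa using (hx.2.2.1.1 p hp).2.2
  have hT : ∀ {x : Equiv.Perm α × Equiv.Perm α × List (α × α)}, IsFact T x →
      ∀ p ∈ x.2.2, ¬ decide (p.2 ∈ S) = true := fun hx p hp => by
    simpa using Finset.disjoint_right.1 hST (hx.2.2.1.1 p hp).2.2
  have h3 : y.2.2 = y'.2.2 := by
    rw [← filter_wmerge_left (fun x => decide (x ∈ S)) (hS hy) (hT hz) hy.2.2.1.2, h.2.2,
      filter_wmerge_left (fun x => decide (x ∈ S)) (hS hy') (hT hz') hy'.2.2.1.2]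
  have h4 : z.2.2 = z'.2.2 := by
    rw [← filter_wmerge_right (fun x => decide (x ∈ S)) (hS hy) (hT hz) hz.2.2.1.2, h.2.2,
      filter_wmerge_right (fun x => decide (x ∈ S)) (hS hy') (hT hz') hz'.2.2.1.2]
  exact ⟨Prod.ext h1.1 (Prod.ext h2.1 h3), Prod.ext h1.2 (Prod.ext h2.2 h4)⟩

theorem IsFact.exists_eq_factMerge {S : Finset α}
    {x : Equiv.Perm α × Equiv.Perm α × List (α × α)} (hx : IsFact S x) {m : α} (hm : m ∈ S) :
    ∃ y z, IsFact (factOrbit x m) y ∧ FactTransitive (factOrbit x m) y ∧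
      IsFact (S \ factOrbit x m) z ∧ factMerge y z = x := by
  set T := factOrbit x m with hT
  have hTS : T ⊆ S := hx.factOrbit_subset hm
  have hdis : Disjoint T (S \ T) := Finset.disjoint_sdiff
  have hstep : ∀ a b, FactStep x a b → (a ∈ T ↔ b ∈ T) := fun a b h => by
    rw [hT, mem_factOrbit, mem_factOrbit]
    exact ⟨fun h' => h'.trans _ _ _ (.rel _ _ h), fun h' => h'.trans _ _ _ (.symm _ _ (.rel _ _ h))⟩
  obtain ⟨ρ₀, ρ₁, hρ₀, hρ₁, hρ⟩ := exists_eq_mul_of_preserves hx.1 fun a =>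
    (hstep a _ (Or.inl rfl)).symm
  obtain ⟨σ₀, σ₁, hσ₀, hσ₁, hσ⟩ := exists_eq_mul_of_preserves hx.2.1 fun a =>
    (hstep a _ (Or.inr (Or.inl rfl))).symm
  have hword : ∀ p ∈ x.2.2, (p.1 ∈ T ↔ p.2 ∈ T) := fun p hp => hstep _ _ (Or.inr (Or.inr hp))
  have hL₀ : MonoWord T (x.2.2.filter fun p => decide (p.2 ∈ T)) := by
    refine ⟨fun p hp => ?_, hx.2.2.1.2.filter _⟩
    rw [List.mem_filter, decide_eq_true_eq] at hp
    exact ⟨(hx.2.2.1.1 p hp.1).1, (hword p hp.1).2 hp.2, hp.2⟩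
  have hL₁ : MonoWord (S \ T) (x.2.2.filter fun p => !decide (p.2 ∈ T)) := by
    refine ⟨fun p hp => ?_, hx.2.2.1.2.filter _⟩
    rw [List.mem_filter, Bool.not_eq_true', decide_eq_false_iff_not] at hp
    have := hx.2.2.1.1 p hp.1
    exact ⟨this.1, Finset.mem_sdiff.2 ⟨this.2.1, fun h => hp.2 ((hword p hp.1).1 h)⟩,
      Finset.mem_sdiff.2 ⟨this.2.2, hp.2⟩⟩
  have hmerge : factMerge (ρ₀, σ₀, x.2.2.filter fun p => decide (p.2 ∈ T))
      (ρ₁, σ₁, x.2.2.filter fun p => !decide (p.2 ∈ T)) = x := by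
    refine Prod.ext hρ.symm (Prod.ext hσ.symm ?_)
    refine eq_of_filter_eq (fun a => decide (a ∈ T)) (pairwise_wmerge _ _) hx.2.2.1.2 ?_ ?_
    · exact filter_wmerge_left (fun a => decide (a ∈ T)) (by simp) (by simp) hL₀.2
    · exact filter_wmerge_right (fun a => decide (a ∈ T)) (by simp) (by simp) hL₁.2
  have hfact := (isFact_factMerge_iff hdis (y := (ρ₀, σ₀, _)) (z := (ρ₁, σ₁, _))
    hρ₀ hσ₀ hL₀ hρ₁ hσ₁ hL₁).1 (by
      rw [hmerge, Finset.union_sdiff_of_subset hTS]; exact hx)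
  refine ⟨_, _, hfact.1, fun a ha b hb => ?_, hfact.2, hmerge⟩
  have hab : Relation.EqvGen (FactStep x) a b :=
    (Relation.EqvGen.symm _ _ (mem_factOrbit.1 ha)).trans _ _ _ (mem_factOrbit.1 hb)
  refine eqvGen_of_preserves hstep (fun a ha b hab => ?_) hab ha
  rw [← hmerge] at hab
  exact (factStep_factMerge_iff hdis hρ₁ hσ₁ hL₁ ha).1 hab

end Factorizations

section FactorizationSeries

variable {α : Type*} [LinearOrder α] [Fintype α] {N : ℕ}

theorem cyclePower_mul {A : Matrix (Fin N) (Fin N) ℂ} {S T : Finset α} (hST : Disjoint S T)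
    {ρ ρ' : Equiv.Perm α} (h : ρ.support ⊆ S) (h' : ρ'.support ⊆ T) :
    cyclePower A (S.card + T.card) (ρ * ρ') =
      cyclePower A S.card ρ * cyclePower A T.card ρ' := by
  have hdis := disjoint_of_support_subset hST h h'
  have h1 := Finset.card_le_card h
  have h2 := Finset.card_le_card h'
  rw [cyclePower, cyclePower, cyclePower, hdis.cycleType_mul, hdis.card_support_mul,
    Multiset.map_add, Multiset.prod_add,
    show S.card + T.card - (ρ.support.card + ρ'.support.card) =
      (S.card - ρ.support.card) + (T.card - ρ'.support.card) by omega, pow_add]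
  ring

/-- The weight of a factorization. -/
noncomputable def factWeight (A B : Matrix (Fin N) (Fin N) ℂ) (t : ℂ) (n : ℕ)
    (x : Equiv.Perm α × Equiv.Perm α × List (α × α)) : ℂ :=
  (-1) ^ n * cyclePower A n x.1 * cyclePower B n x.2.1 * t ^ x.2.2.length

theorem summable_norm_factWeight (A B : Matrix (Fin N) (Fin N) ℂ) {t : ℂ}
    (ht : ‖t‖ * Fintype.card (α × α) < 1) (n : ℕ) :
    Summable fun x : Equiv.Perm α × Equiv.Perm α × List (α × α) => ‖factWeight A B t n x‖ := by
  have h1 : Summable fun ρ : Equiv.Perm α => ‖cyclePower A n ρ‖ := (hasSum_fintype _).summable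
  have h2 : Summable fun ρ : Equiv.Perm α => ‖cyclePower B n ρ‖ := (hasSum_fintype _).summable
  have h3 := summable_pow_length (norm_nonneg t) ht
  have h4 := h2.mul_of_nonneg h3 (fun _ => norm_nonneg _) fun _ => by positivity
  have h5 := h1.mul_of_nonneg h4 (fun _ => norm_nonneg _) fun _ => by positivity
  refine h5.congr fun x => ?_
  simp [factWeight, mul_assoc]

theorem factWeight_factMerge (A B : Matrix (Fin N) (Fin N) ℂ) (t : ℂ) {S T : Finset α}
    (hST : Disjoint S T) {y z : Equiv.Perm α × Equiv.Perm α × List (α × α)} (hy : IsFact S y)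
    (hz : IsFact T z) : factWeight A B t (S.card + T.card) (factMerge y z) =
      factWeight A B t S.card y * factWeight A B t T.card z := by
  simp only [factWeight, factMerge, cyclePower_mul hST hy.1 hz.1,
    cyclePower_mul hST hy.2.1 hz.2.1, (wmerge_perm _ _).length_eq, List.length_append, pow_add]
  ring

open Classical in
/-- The generating series of the factorizations on `S` satisfying `P`. -/
noncomputable def factSeries (A B : Matrix (Fin N) (Fin N) ℂ) (t : ℂ) (S : Finset α)
    (P : Equiv.Perm α × Equiv.Perm α × List (α × α) → Prop) : ℂ :=
  ∑' x : Equiv.Perm α × Equiv.Perm α × List (α × α),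
    if IsFact S x ∧ P x then factWeight A B t S.card x else 0

theorem summable_norm_ite_factWeight (A B : Matrix (Fin N) (Fin N) ℂ) {t : ℂ}
    (ht : ‖t‖ * Fintype.card (α × α) < 1) (n : ℕ)
    (P : Equiv.Perm α × Equiv.Perm α × List (α × α) → Prop) [DecidablePred P] :
    Summable fun x : Equiv.Perm α × Equiv.Perm α × List (α × α) =>
      ‖if P x then factWeight A B t n x else 0‖ := by
  refine (summable_norm_factWeight A B ht n).of_nonneg_of_le (fun _ => norm_nonneg _) fun x => ?_
  split_ifs
  · rfl
  · simp

theorem factSeries_eq_tsum (A B : Matrix (Fin N) (Fin N) ℂ) (t : ℂ) (S : Finset α)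
    (P : Equiv.Perm α × Equiv.Perm α × List (α × α) → Prop)
    [DecidablePred fun x => IsFact S x ∧ P x] :
    factSeries A B t S P = ∑' x : Equiv.Perm α × Equiv.Perm α × List (α × α),
      if IsFact S x ∧ P x then factWeight A B t S.card x else 0 := by
  unfold factSeries
  congr!

theorem factSeries_factOrbit (A B : Matrix (Fin N) (Fin N) ℂ) {t : ℂ}
    (ht : ‖t‖ * Fintype.card (α × α) < 1) {S T : Finset α} (hTS : T ⊆ S) {m : α} (hm : m ∈ T) :
    factSeries A B t S (fun x => factOrbit x m = T) =
      factSeries A B t T (FactTransitive T) * factSeries A B t (S \ T) (fun _ => True) := by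
  classical
  have hdis : Disjoint T (S \ T) := Finset.disjoint_sdiff
  have hcard : T.card + (S \ T).card = S.card := by
    rw [add_comm]; exact Finset.card_sdiff_add_card_eq_card hTS
  rw [factSeries_eq_tsum, factSeries_eq_tsum, factSeries_eq_tsum, tsum_mul_tsum_of_summable_norm
    (summable_norm_ite_factWeight A B ht _ _) (summable_norm_ite_factWeight A B ht _ _)]
  have hmem : ∀ p : (Equiv.Perm α × Equiv.Perm α × List (α × α)) ×
      (Equiv.Perm α × Equiv.Perm α × List (α × α)),
      ((if IsFact T p.1 ∧ FactTransitive T p.1 then factWeight A B t T.card p.1 else 0) *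
        (if IsFact (S \ T) p.2 ∧ True then factWeight A B t (S \ T).card p.2 else 0)) ≠ 0 →
      IsFact T p.1 ∧ FactTransitive T p.1 ∧ IsFact (S \ T) p.2 := fun p hp => by
    have h1 := left_ne_zero_of_mul hp
    have h2 := right_ne_zero_of_mul hp
    rw [ne_eq, ite_eq_right_iff, Classical.not_imp] at h1 h2
    exact ⟨h1.1.1, h1.1.2, h2.1.1⟩
  refine tsum_eq_tsum_of_ne_zero_bij (fun p => factMerge p.1.1 p.1.2) ?_ ?_ ?_
  · rintro ⟨p, hp⟩ ⟨q, hq⟩ hpq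
    have hp := hmem p hp
    have hq := hmem q hq
    have := factMerge_injective hdis hp.1 hp.2.2 hq.1 hq.2.2 hpq
    exact Subtype.ext (Prod.ext this.1 this.2)
  · intro x hx
    rw [Function.mem_support, ne_eq, ite_eq_right_iff, Classical.not_imp] at hx
    obtain ⟨⟨hx, rfl⟩, hw⟩ := hx
    obtain ⟨y, z, hy, hyt, hz, rfl⟩ := hx.exists_eq_factMerge (hTS hm)
    refine ⟨⟨(y, z), ?_⟩, rfl⟩
    rw [Function.mem_support]
    simp only [hy, hyt, hz, and_self, if_true]
    rwa [← factWeight_factMerge A B t hdis hy hz, hcard]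
  · rintro ⟨⟨y, z⟩, hp⟩
    obtain ⟨hy, hyt, hz⟩ := hmem _ hp
    have h1 : IsFact S (factMerge y z) := by
      have := (isFact_factMerge_iff hdis hy.1 hy.2.1 hy.2.2.1 hz.1 hz.2.1 hz.2.2.1).2 ⟨hy, hz⟩
      rwa [Finset.union_sdiff_of_subset hTS] at this
    have h2 := factOrbit_factMerge hdis hy hyt hz hm
    simp only [hy, hyt, hz, h1, h2, and_self, if_true]
    rw [← factWeight_factMerge A B t hdis hy hz, hcard]

/-- The exponential formula, in recursive form. -/
theorem factSeries_eq_sum (A B : Matrix (Fin N) (Fin N) ℂ) {t : ℂ}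
    (ht : ‖t‖ * Fintype.card (α × α) < 1) {S : Finset α} {m : α} (hm : m ∈ S) :
    factSeries A B t S (fun _ => True) = ∑ T ∈ S.powerset with m ∈ T,
      factSeries A B t T (FactTransitive T) * factSeries A B t (S \ T) (fun _ => True) := by
  classical
  trans ∑ T ∈ S.powerset with m ∈ T, factSeries A B t S (fun x => factOrbit x m = T)
  · simp only [factSeries_eq_tsum]
    rw [← Summable.tsum_finsetSum fun T _ => (summable_norm_ite_factWeight A B ht _ _).of_norm]
    refine tsum_congr fun x => ?_
    by_cases hx : IsFact S x
    · simp only [hx, true_and, and_self, if_true]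
      rw [Finset.sum_ite_eq, if_pos]
      rw [Finset.mem_filter, Finset.mem_powerset]
      exact ⟨hx.factOrbit_subset hm, mem_factOrbit.2 (.refl _)⟩
    · simp [hx]
  · refine Finset.sum_congr rfl fun T hT => ?_
    rw [Finset.mem_filter, Finset.mem_powerset] at hT
    exact factSeries_factOrbit A B ht hT.1 hT.2

theorem factSeries_eq_sum_wgen (A B : Matrix (Fin N) (Fin N) ℂ) {t : ℂ}
    (ht : ‖t‖ * Fintype.card (α × α) < 1) (S : Finset α) :
    factSeries A B t S (fun _ => True) = (-1) ^ S.card *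
      ∑ ρ : Equiv.Perm α with ρ.support ⊆ S, ∑ σ : Equiv.Perm α with σ.support ⊆ S,
        cyclePower A S.card ρ * cyclePower B S.card σ * wgen t S (ρ * σ)⁻¹ := by
  classical
  have hsum := (summable_norm_ite_factWeight A B ht S.card fun x => IsFact S x ∧ True).of_norm
  rw [factSeries_eq_tsum, hsum.tsum_prod, tsum_fintype, Finset.mul_sum, Finset.sum_filter]
  refine Finset.sum_congr rfl fun ρ _ => ?_
  rw [(hsum.prod_factor ρ).tsum_prod, tsum_fintype]
  split_ifs with hρ
  · rw [Finset.mul_sum, Finset.sum_filter]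
    refine Finset.sum_congr rfl fun σ _ => ?_
    split_ifs with hσ
    · rw [wgen, ← mul_assoc, ← tsum_mul_left]
      refine tsum_congr fun L => ?_
      simp only [IsFact, hρ, hσ, true_and, and_true, factWeight, mul_eq_one_iff_eq_inv',
        mul_ite, mul_zero, ← mul_assoc]
    · simp [IsFact, hσ]
  · simp [IsFact, hρ]

theorem factSeries_eq_iteratedDeriv (μ : Measure (Matrix.unitaryGroup (Fin N) ℂ))
    [μ.IsHaarMeasure] [IsProbabilityMeasure μ] (A B : Matrix (Fin N) (Fin N) ℂ) (hN0 : N ≠ 0)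
    (hN : ‖-(N : ℂ)⁻¹‖ * Fintype.card (α × α) < 1) (S : Finset α) (hS : S.card ≤ N) :
    factSeries A B (-(N : ℂ)⁻¹) S (fun _ => True) = iteratedDeriv S.card (hciz μ A B) 0 := by
  rw [factSeries_eq_sum_wgen A B hN, ← integral_trace_pow_eq_sum μ A B hN0 hN S hS,
    iteratedDeriv_hciz, ← mul_assoc, ← mul_pow, neg_one_mul]

end FactorizationSeries

theorem sum_powerset_mem_apply_card {α M : Type*} [DecidableEq α] [AddCommMonoid M]
    (g : ℕ → M) {S : Finset α} {m : α} (hm : m ∈ S) {n : ℕ} (hn : S.card = n + 1) :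
    ∑ T ∈ S.powerset with m ∈ T, g T.card =
      ∑ k ∈ Finset.range (n + 1), n.choose k • g (k + 1) := by
  have hcard : (S.erase m).card = n := by rw [Finset.card_erase_of_mem hm, hn]; rfl
  have h : S.powerset.filter (m ∈ ·) = (S.erase m).powerset.image (insert m) := by
    ext T
    simp only [Finset.mem_filter, Finset.mem_powerset, Finset.mem_image]
    constructor
    · rintro ⟨hT, hmT⟩
      exact ⟨T.erase m, Finset.erase_subset_erase m hT, Finset.insert_erase hmT⟩
    · rintro ⟨T, hT, rfl⟩
      exact ⟨Finset.insert_subset hm (hT.trans (Finset.erase_subset _ _)),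
        Finset.mem_insert_self _ _⟩
  have hnot : ∀ T ∈ (S.erase m).powerset, m ∉ T := fun T hT hmT =>
    Finset.notMem_erase m S (Finset.mem_powerset.1 hT hmT)
  rw [h, Finset.sum_image fun T hT T' hT' h => by
    rw [← Finset.erase_insert (hnot T hT), h, Finset.erase_insert (hnot T' hT')]]
  rw [← hcard, ← Finset.sum_powerset_apply_card fun k => g (k + 1)]
  exact Finset.sum_congr rfl fun T hT => by rw [Finset.card_insert_of_notMem (hnot T hT)]

theorem eq_of_exponential_formula {α : Type*} [DecidableEq α] {a c : Finset α → ℂ}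
    {a' c' : ℕ → ℂ} (h : ∀ S, ∀ m ∈ S, a S = ∑ T ∈ S.powerset with m ∈ T, c T * a (S \ T))
    (ha : ∀ S, a S = a' S.card) (ha' : a' 0 = 1)
    (h' : ∀ n, a' (n + 1) =
      ∑ k ∈ Finset.range (n + 1), (n.choose k : ℂ) * c' (k + 1) * a' (n - k))
    (S : Finset α) (hS : S.Nonempty) : c S = c' S.card := by
  induction S using Finset.strongInduction with
  | H S ih =>
    obtain ⟨m, hm⟩ := hS
    obtain ⟨n, hn⟩ : ∃ n, S.card = n + 1 :=
      ⟨S.card - 1, (Nat.sub_add_cancel (Finset.card_pos.2 ⟨m, hm⟩)).symm⟩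
    have h1 : ∑ T ∈ S.powerset with m ∈ T, (c T * a (S \ T) - c' T.card * a' (S.card - T.card)) =
        c S - c' S.card := by
      rw [Finset.sum_eq_single S]
      · simp [ha, ha']
      · intro T hT hTS
        rw [Finset.mem_filter, Finset.mem_powerset] at hT
        rw [ih T (hT.1.ssubset_of_ne hTS) ⟨m, hT.2⟩, ha, Finset.card_sdiff_of_subset hT.1, sub_self]
      · intro hS
        exact absurd (Finset.mem_filter.2 ⟨Finset.mem_powerset_self S, hm⟩) hS
    rw [Finset.sum_sub_distrib, ← h S m hm, ha,
      sum_powerset_mem_apply_card (fun k => c' k * a' (S.card - k)) hm hn, hn, h'] at h1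
    rw [hn, ← sub_eq_zero, ← h1, sub_eq_zero]
    refine Finset.sum_congr rfl fun k _ => ?_
    rw [Nat.add_sub_add_right, nsmul_eq_mul, mul_assoc]

theorem factSeries_eq_iteratedDeriv_log {α : Type*} [LinearOrder α] [Fintype α] {N : ℕ}
    (μ : Measure (Matrix.unitaryGroup (Fin N) ℂ))
    [μ.IsHaarMeasure] [IsProbabilityMeasure μ] (A B : Matrix (Fin N) (Fin N) ℂ) (hN0 : N ≠ 0)
    (hN : ‖-(N : ℂ)⁻¹‖ * Fintype.card (α × α) < 1) (hα : Fintype.card α ≤ N) {f : ℂ → ℂ}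
    (hf : AnalyticAt ℂ f 0) (hf0 : f 0 = 0)
    (hfI : (fun z => Complex.exp (f z)) =ᶠ[nhds 0] hciz μ A B) {S : Finset α}
    (hS : S.Nonempty) :
    factSeries A B (-(N : ℂ)⁻¹) S (FactTransitive S) = iteratedDeriv S.card f 0 := by
  classical
  refine eq_of_exponential_formula (a := fun S => factSeries A B (-(N : ℂ)⁻¹) S fun _ => True)
    (c := fun S => factSeries A B (-(N : ℂ)⁻¹) S (FactTransitive S))
    (a' := fun n => iteratedDeriv n (fun z => Complex.exp (f z)) 0)
    (c' := fun n => iteratedDeriv n f 0) (fun S m hm => ?_) (fun S => ?_) ?_ (fun n => ?_) S hS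
  · convert factSeries_eq_sum A B hN hm
  · rw [factSeries_eq_iteratedDeriv μ A B hN0 hN S ((Finset.card_le_univ S).trans hα),
      hfI.iteratedDeriv_eq]
  · simp [hf0]
  · exact iteratedDeriv_exp_comp_succ hf n

section GenusBound

/-- The functions invariant under `π` and under the transpositions of `L`. -/
def invFun {α : Type*} (π : Equiv.Perm α) (L : List (α × α)) :
    Submodule (ZMod 2) (α → ZMod 2) where
  carrier := {i | (∀ a, i (π a) = i a) ∧ ∀ p ∈ L, i p.1 = i p.2}
  add_mem' h h' := ⟨fun a => by simp [h.1 a, h'.1 a], fun p hp => by simp [h.2 p hp, h'.2 p hp]⟩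
  zero_mem' := ⟨fun _ => rfl, fun _ _ => rfl⟩
  smul_mem' c i h := ⟨fun a => by simp [h.1 a], fun p hp => by simp [h.2 p hp]⟩

theorem mem_invFun {α : Type*} {π : Equiv.Perm α} {L : List (α × α)} {i : α → ZMod 2} :
    i ∈ invFun π L ↔ (∀ a, i (π a) = i a) ∧ ∀ p ∈ L, i p.1 = i p.2 := Iff.rfl

theorem apply_swap_of_eq {α β : Type*} [DecidableEq α] {i : α → β} {a b : α} (h : i a = i b)
    (x : α) : i (Equiv.swap a b x) = i x := by
  rw [Equiv.swap_apply_def]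
  split_ifs with h1 h2
  · rw [h1, h]
  · rw [h2, h]
  · rfl

theorem invFun_swap_mul {α : Type*} [DecidableEq α] (π : Equiv.Perm α) (a b : α)
    (L : List (α × α)) :
    invFun (Equiv.swap a b * π) ((a, b) :: L) = invFun π ((a, b) :: L) := by
  ext i
  rw [mem_invFun, mem_invFun]
  refine and_congr_left fun h => forall_congr' fun x => ?_
  rw [Equiv.Perm.mul_apply, apply_swap_of_eq (h (a, b) (by simp))]

variable {α : Type*} [Fintype α]

theorem finrank_invFun_le (π : Equiv.Perm α) (a b : α) (L : List (α × α)) :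
    Module.finrank (ZMod 2) (invFun π L) ≤
      Module.finrank (ZMod 2) (invFun π ((a, b) :: L)) + 1 := by
  set f : (α → ZMod 2) →ₗ[ZMod 2] ZMod 2 := 
    LinearMap.proj (R := ZMod 2) (φ := fun _ : α => ZMod 2) a - LinearMap.proj b
  set g : invFun π L →ₗ[ZMod 2] ZMod 2 := f.domRestrict (invFun π L)
  have h1 := LinearMap.finrank_range_add_finrank_ker g
  have h2 : Module.finrank (ZMod 2) (LinearMap.range g) ≤ 1 :=
    (Submodule.finrank_le _).trans (by simp)
  have h3 : Module.finrank (ZMod 2) (LinearMap.ker g) ≤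
      Module.finrank (ZMod 2) (invFun π ((a, b) :: L)) := by
    rw [← Submodule.finrank_map_subtype_eq]
    refine Submodule.finrank_mono ?_
    rintro _ ⟨⟨i, hi⟩, hg, rfl⟩
    refine ⟨hi.1, List.forall_mem_cons.2 ⟨?_, hi.2⟩⟩
    exact sub_eq_zero.1 (LinearMap.mem_ker.1 hg)
  omega

theorem finrank_invFun_nil [DecidableEq α] (π : Equiv.Perm α) :
    Module.finrank (ZMod 2) (invFun π []) = π.partition.parts.card := by
  have h1 := permTrace_eq_cyclePower (1 : Matrix (Fin 2) (Fin 2) ℂ) π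
  rw [permTrace_one_eq] at h1
  have h2 : cyclePower (1 : Matrix (Fin 2) (Fin 2) ℂ) (Fintype.card α) π =
      2 ^ π.partition.parts.card := by
    simp [cyclePower, Equiv.Perm.parts_partition, pow_add]
  have h3 : (∑ i : α → Fin 2, if ∀ k, i (π k) = i k then (1 : ℂ) else 0) =
      (Nat.card (invFun π []) : ℂ) := by
    classical
    rw [← Finset.natCast_card_filter, Nat.card_eq_fintype_card, ← Fintype.card_subtype]
    congr 1
    refine Fintype.card_congr (Equiv.subtypeEquivRight fun i => ?_)
    exact ⟨fun h => ⟨h, fun p hp => absurd hp List.not_mem_nil⟩, fun h => h.1⟩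
  rw [h3, h2, Module.natCard_eq_pow_finrank (K := ZMod 2), Nat.card_zmod] at h1
  exact Nat.pow_right_injective le_rfl (by exact_mod_cast h1)

theorem sign_eq_neg_one_pow [DecidableEq α] (π : Equiv.Perm α) :
    Equiv.Perm.sign π = (-1) ^ (Fintype.card α + π.partition.parts.card) := by
  have h := Finset.card_le_univ π.support
  rw [Equiv.Perm.sign_of_cycleType, Equiv.Perm.sum_cycleType, Equiv.Perm.parts_partition,
    Multiset.card_add, Multiset.card_replicate]
  have : Fintype.card α + (π.cycleType.card + (Fintype.card α - π.support.card)) =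
    (π.support.card + π.cycleType.card) + 2 * (Fintype.card α - π.support.card) := by omega
  rw [this, pow_add _ _ (2 * _), pow_mul]
  simp

theorem card_parts_swap_mul [DecidableEq α] (π : Equiv.Perm α) {a b : α} (hab : a ≠ b) :
    (Equiv.swap a b * π).partition.parts.card ≠ π.partition.parts.card := by
  intro h
  have h1 := sign_eq_neg_one_pow (Equiv.swap a b * π)
  rw [h, ← sign_eq_neg_one_pow, Equiv.Perm.sign_mul, Equiv.Perm.sign_swap hab] at h1
  have h2 : (-1 : ℤˣ) = 1 := mul_right_cancel (h1.trans (one_mul _).symm)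
  exact absurd h2 (by decide)

end GenusBound

section GenusBoundWords

variable {α : Type*} [LinearOrder α] [Fintype α]

theorem apply_wprod {α : Type*} [LinearOrder α] {i : α → ZMod 2} {L : List (α × α)}
    (h : ∀ p ∈ L, i p.1 = i p.2) (x : α) : i (wprod L x) = i x := by
  induction L with
  | nil => rfl
  | cons p L ih =>
    have h1 : wprod (p :: L) = Equiv.swap p.1 p.2 * wprod L := by simp [wprod]
    rw [h1, Equiv.Perm.mul_apply, apply_swap_of_eq (h p (by simp)),
      ih fun q hq => h q (by simp [hq])]

theorem card_parts_add_card_parts_le (π : Equiv.Perm α) {L : List (α × α)}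
    (hL : ∀ p ∈ L, p.1 ≠ p.2) :
    π.partition.parts.card + (wprod L * π).partition.parts.card ≤
      L.length + 2 * Module.finrank (ZMod 2) (invFun π L) := by
  induction L with
  | nil =>
    have h1 : wprod ([] : List (α × α)) = 1 := rfl
    rw [h1, one_mul, finrank_invFun_nil, List.length_nil]
    omega
  | cons p L ih =>
    obtain ⟨a, b⟩ := p
    have ih := ih fun q hq => hL q (by simp [hq])
    have hab : a ≠ b := hL (a, b) (by simp)
    have h1 : wprod ((a, b) :: L) * π = Equiv.swap a b * (wprod L * π) := by
      simp [wprod, mul_assoc]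
    have h2 : Module.finrank (ZMod 2) (invFun (Equiv.swap a b * (wprod L * π)) []) ≤ _ :=
      finrank_invFun_le _ a b []
    rw [invFun_swap_mul, finrank_invFun_nil] at h2
    have hle : invFun (wprod L * π) [(a, b)] ≤ invFun (wprod L * π) [] := fun i hi =>
      ⟨hi.1, by simp⟩
    rw [h1, List.length_cons]
    by_cases hW : invFun π L ≤ invFun π ((a, b) :: L)
    · have h3 := Submodule.finrank_mono hW
      have h4 := Submodule.finrank_mono hle
      rw [finrank_invFun_nil] at h4
      omega
    · obtain ⟨i, hi, hi'⟩ := SetLike.not_le_iff_exists.1 hW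
      have hne : i a ≠ i b := fun h => hi' ⟨hi.1, by
        rw [List.forall_mem_cons]; exact ⟨h, hi.2⟩⟩
      have hlt : invFun (wprod L * π) [(a, b)] < invFun (wprod L * π) [] := by
        refine lt_of_le_of_ne hle fun h => hne ?_
        have : i ∈ invFun (wprod L * π) [] := ⟨fun x => by
          rw [Equiv.Perm.mul_apply, apply_wprod hi.2, hi.1], by simp⟩
        rw [← h] at this
        exact this.2 (a, b) (by simp)
      have h3 := Submodule.finrank_lt_finrank_of_lt hlt
      rw [finrank_invFun_nil] at h3
      have h4 := card_parts_swap_mul (wprod L * π) hab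
      have h5 := finrank_invFun_le π a b L
      omega

/-- The Riemann–Hurwitz bound. -/
theorem card_parts_le_of_factTransitive {x : Equiv.Perm α × Equiv.Perm α × List (α × α)}
    (hx : IsFact Finset.univ x) (ht : FactTransitive Finset.univ x) :
    x.1.partition.parts.card + x.2.1.partition.parts.card ≤ x.2.2.length + 2 := by
  have h1 := card_parts_add_card_parts_le x.1 fun p hp => (hx.2.2.1.1 p hp).1.ne
  have h2 : wprod x.2.2 * x.1 = x.2.1⁻¹ := by
    rw [eq_inv_of_mul_eq_one_right hx.2.2.2, _root_.mul_inv_rev, inv_mul_cancel_right]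
  have h3 : x.2.1⁻¹.partition.parts.card = x.2.1.partition.parts.card := by
    simp [Equiv.Perm.parts_partition]
  have h4 : Module.finrank (ZMod 2) (invFun x.1 x.2.2) ≤ 1 := by
    have hle : invFun x.1 x.2.2 ≤ Submodule.span (ZMod 2) {fun _ => 1} := by
      intro i hi
      have hσ : ∀ a, i (x.2.1 a) = i a := fun a => by
        have h : (wprod x.2.2 * x.1) (x.2.1 a) = a := by simp [h2]
        rw [← hi.1 (x.2.1 a), ← apply_wprod hi.2, ← Equiv.Perm.mul_apply, h]
      have hconst : ∀ a b, i a = i b := fun a b => by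
        induction ht a (Finset.mem_univ _) b (Finset.mem_univ _) with
        | rel a b h =>
          rcases h with rfl | rfl | h
          · exact (hi.1 a).symm
          · exact (hσ a).symm
          · exact hi.2 _ h
        | refl => rfl
        | symm _ _ _ ih => exact ih.symm
        | trans _ _ _ _ _ ih ih' => exact ih.trans ih'
      rw [Submodule.mem_span_singleton]
      rcases isEmpty_or_nonempty α with hα | ⟨⟨a⟩⟩
      · exact ⟨0, Subsingleton.elim _ _⟩
      · exact ⟨i a, funext fun b => by simp [hconst a b]⟩
    exact (Submodule.finrank_mono hle).trans (finrank_span_le_card _ |>.trans (by simp))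
  rw [h2, h3] at h1
  omega

end GenusBoundWords

section TupleCount

variable {d : ℕ}

/-- The number of monotone tuples completing `ρ`, `σ` to a transitive factorization. -/
noncomputable def tupleCount (ρ σ : Equiv.Perm (Fin d)) (r : ℕ) : ℕ :=
  Nat.card {τ : Fin r → Equiv.Perm (Fin d) // IsMonotoneTuple τ ∧
    ρ * σ * (List.ofFn τ).prod = 1 ∧ GeneratesTransitively ({ρ, σ} ∪ Set.range τ)}

open Classical in
theorem Hr_eq_sum (α β : d.Partition) (r : ℕ) : Hr d α β r =
    ∑ ρ : Equiv.Perm (Fin d), ∑ σ : Equiv.Perm (Fin d),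
      if HasCycleType ρ α ∧ HasCycleType σ β then tupleCount ρ σ r else 0 := by
  rw [Hr, Nat.card_eq_fintype_card, Fintype.card_subtype, Finset.card_filter,
    Fintype.sum_prod_type]
  refine Finset.sum_congr rfl fun ρ _ => ?_
  rw [Fintype.sum_prod_type]
  refine Finset.sum_congr rfl fun σ _ => ?_
  split_ifs with h
  · rw [tupleCount, Nat.card_eq_fintype_card, Fintype.card_subtype, Finset.card_filter]
    simp only [h.1, h.2, true_and]
  · refine Finset.sum_eq_zero fun τ _ => if_neg fun h' => h ⟨h'.1, h'.2.1⟩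

theorem generatesTransitively_iff {ρ σ : Equiv.Perm (Fin d)} {r : ℕ}
    (f : Fin r → Fin d × Fin d) :
    GeneratesTransitively ({ρ, σ} ∪ Set.range fun i => Equiv.swap (f i).1 (f i).2) ↔
      FactTransitive Finset.univ (ρ, σ, List.ofFn f) := by
  constructor
  · intro h a _ b _
    obtain ⟨g, hg, rfl⟩ := h a b
    clear h
    induction hg using Subgroup.closure_induction generalizing a with
    | mem g hg =>
      rcases hg with hg | ⟨i, rfl⟩
      · rcases hg with rfl | rfl
        · exact .rel _ _ (Or.inl rfl)
        · exact .rel _ _ (Or.inr (Or.inl rfl))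
      · have hi : ((f i).1, (f i).2) ∈ List.ofFn f := List.mem_ofFn.2 ⟨i, rfl⟩
        simp only [Equiv.swap_apply_def]
        split_ifs with h1 h2
        · rw [h1]; exact .rel _ _ (Or.inr (Or.inr hi))
        · rw [h2]; exact .symm _ _ (.rel _ _ (Or.inr (Or.inr hi)))
        · exact .refl _
    | one => exact .refl _
    | mul g g' _ _ ih ih' =>
      exact (ih' a (Finset.mem_univ _) (Finset.mem_univ _)).trans _ _ _
        (ih (g' a) (Finset.mem_univ _) (Finset.mem_univ _))
    | inv g _ ih =>
      have := ih (g⁻¹ a) (Finset.mem_univ _) (Finset.mem_univ _)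
      rw [show g (g⁻¹ a) = a from g.apply_symm_apply a] at this
      exact this.symm
  · intro h a b
    induction h a (Finset.mem_univ _) b (Finset.mem_univ _) with
    | rel a b hab =>
      rcases hab with rfl | rfl | hab
      · exact ⟨ρ, Subgroup.subset_closure (by simp), rfl⟩
      · exact ⟨σ, Subgroup.subset_closure (by simp), rfl⟩
      · obtain ⟨i, hi⟩ := List.mem_ofFn.1 hab
        refine ⟨Equiv.swap (f i).1 (f i).2, Subgroup.subset_closure (Or.inr ⟨i, rfl⟩), ?_⟩
        rw [hi, Equiv.swap_apply_left]
    | refl a => exact ⟨1, one_mem _, rfl⟩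
    | symm a b _ ih =>
      obtain ⟨g, hg, rfl⟩ := ih
      exact ⟨g⁻¹, inv_mem hg, by simp⟩
    | trans a b c _ _ ih ih' =>
      obtain ⟨g, hg, rfl⟩ := ih
      obtain ⟨g', hg', rfl⟩ := ih'
      exact ⟨g' * g, mul_mem hg' hg, rfl⟩

theorem max_support_swap {a b : Fin d} (h : a < b) : (Equiv.swap a b).support.max = b := by
  rw [Equiv.Perm.support_swap h.ne]
  simp [h.le]

theorem monoWord_ofFn_iff {r : ℕ} {f : Fin r → Fin d × Fin d} :
    MonoWord Finset.univ (List.ofFn f) ↔ (∀ i, (f i).1 < (f i).2) ∧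
      IsMonotoneTuple fun i => Equiv.swap (f i).1 (f i).2 := by
  simp only [MonoWord, List.forall_mem_ofFn_iff, Finset.mem_univ, and_true, List.pairwise_ofFn]
  refine and_congr_right fun h => ?_
  simp only [IsMonotoneTuple, max_support_swap (h _)]
  constructor
  · intro h'
    refine ⟨fun i => ⟨_, _, (h i).ne, rfl⟩, fun i j hij => ?_⟩
    rcases hij.eq_or_lt with rfl | hij
    · exact le_rfl
    · exact WithBot.coe_le_coe.2 (h' hij)
  · exact fun h' i j hij => WithBot.coe_le_coe.1 (h'.2 hij.le)

theorem wprod_ofFn {r : ℕ} (f : Fin r → Fin d × Fin d) :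
    wprod (List.ofFn f) = (List.ofFn fun i => Equiv.swap (f i).1 (f i).2).prod := by
  rw [wprod, List.map_ofFn]
  rfl

theorem tupleCount_eq (ρ σ : Equiv.Perm (Fin d)) (r : ℕ) : tupleCount ρ σ r =
    Nat.card {f : Fin r → Fin d × Fin d // IsFact Finset.univ (ρ, σ, List.ofFn f) ∧
      FactTransitive Finset.univ (ρ, σ, List.ofFn f)} := by
  symm
  refine Nat.card_congr (Equiv.ofBijective (fun f => ⟨fun i => Equiv.swap (f.1 i).1 (f.1 i).2,
    (monoWord_ofFn_iff.1 f.2.1.2.2.1).2, wprod_ofFn f.1 ▸ f.2.1.2.2.2,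
    (generatesTransitively_iff f.1).2 f.2.2⟩) ⟨?_, ?_⟩)
  · rintro ⟨f, hf⟩ ⟨g, hg⟩ hfg
    refine Subtype.ext (funext fun i => ?_)
    have h1 : Equiv.swap (f i).1 (f i).2 = Equiv.swap (g i).1 (g i).2 :=
      congrFun (Subtype.ext_iff.1 hfg) i
    have hfi := (monoWord_ofFn_iff.1 hf.1.2.2.1).1 i
    have hgi := (monoWord_ofFn_iff.1 hg.1.2.2.1).1 i
    have h2 : (f i).2 = (g i).2 := by
      rw [← WithBot.coe_inj, ← max_support_swap hfi, ← max_support_swap hgi, h1]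
    refine Prod.ext ?_ h2
    rw [← Equiv.swap_apply_right (f i).1 (f i).2, h1, h2, Equiv.swap_apply_right]
  · rintro ⟨τ, hτ, hprod, htrans⟩
    have h1 : ∀ i, ∃ p : Fin d × Fin d, p.1 < p.2 ∧ Equiv.swap p.1 p.2 = τ i := fun i => by
      obtain ⟨a, b, hab, h⟩ := hτ.1 i
      rcases hab.lt_or_gt with hab | hab
      · exact ⟨(a, b), hab, h.symm⟩
      · exact ⟨(b, a), hab, by rw [h, Equiv.swap_comm]⟩
    choose f hf hfτ using h1
    obtain rfl : (fun i => Equiv.swap (f i).1 (f i).2) = τ := funext hfτ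
    exact ⟨⟨f, ⟨Finset.subset_univ _, Finset.subset_univ _, monoWord_ofFn_iff.2 ⟨hf, hτ⟩,
      (wprod_ofFn f).symm ▸ hprod⟩, (generatesTransitively_iff f).1 htrans⟩, rfl⟩

theorem tupleCount_le (ρ σ : Equiv.Perm (Fin d)) (r : ℕ) : tupleCount ρ σ r ≤ (d * d) ^ r := by
  rw [tupleCount_eq]
  refine (Nat.card_le_card_of_injective _ Subtype.val_injective).trans ?_
  simp

theorem tupleCount_eq_zero {ρ σ : Equiv.Perm (Fin d)} {r : ℕ}
    (h : r + 2 < ρ.partition.parts.card + σ.partition.parts.card) : tupleCount ρ σ r = 0 := by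
  rw [tupleCount_eq, Nat.card_eq_zero]
  refine Or.inl ⟨fun f => ?_⟩
  have := card_parts_le_of_factTransitive f.2.1 f.2.2
  rw [List.length_ofFn] at this
  exact absurd this (not_le.2 h)

open Classical in
theorem tsum_word_eq {t : ℂ} (ht : ‖t‖ * Fintype.card (Fin d × Fin d) < 1)
    (ρ σ : Equiv.Perm (Fin d)) :
    (∑' L : List (Fin d × Fin d), if IsFact Finset.univ (ρ, σ, L) ∧
      FactTransitive Finset.univ (ρ, σ, L) then t ^ L.length else 0) =
      ∑' r : ℕ, t ^ r * tupleCount ρ σ r := by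
  have hs := summable_ite_pow_length ht fun L => IsFact Finset.univ (ρ, σ, L) ∧
      FactTransitive Finset.univ (ρ, σ, L)
  rw [← List.equivSigmaTuple.symm.tsum_eq]
  rw [← List.equivSigmaTuple.symm.summable_iff] at hs
  refine (Summable.tsum_sigma hs).trans ?_
  refine tsum_congr fun r => ?_
  rw [tsum_fintype, tupleCount_eq, Nat.card_eq_fintype_card, Fintype.card_subtype,
    Finset.natCast_card_filter, Finset.mul_sum]
  refine Finset.sum_congr rfl fun f _ => ?_
  simp [List.equivSigmaTuple]

theorem factSeries_eq_sum_tupleCount {N : ℕ} (A B : Matrix (Fin N) (Fin N) ℂ) {t : ℂ}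
    (ht : ‖t‖ * Fintype.card (Fin d × Fin d) < 1) :
    factSeries A B t (Finset.univ : Finset (Fin d)) (FactTransitive Finset.univ) =
      ∑ ρ : Equiv.Perm (Fin d), ∑ σ : Equiv.Perm (Fin d),
        (-1) ^ d * cyclePower A d ρ * cyclePower B d σ * ∑' r : ℕ, t ^ r * tupleCount ρ σ r := by
  classical
  have hsum := (summable_norm_ite_factWeight A B ht (Finset.univ : Finset (Fin d)).card
    fun x => IsFact Finset.univ x ∧ FactTransitive Finset.univ x).of_norm
  rw [factSeries_eq_tsum, hsum.tsum_prod, tsum_fintype]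
  refine Finset.sum_congr rfl fun ρ _ => ?_
  rw [(hsum.prod_factor ρ).tsum_prod, tsum_fintype]
  refine Finset.sum_congr rfl fun σ _ => ?_
  rw [← tsum_word_eq ht, ← tsum_mul_left]
  refine tsum_congr fun L => ?_
  simp only [factWeight, Finset.card_univ, Fintype.card_fin, mul_ite, mul_zero]

theorem cyclePower_eq_prod_parts {N : ℕ} (A : Matrix (Fin N) (Fin N) ℂ)
    (ρ : Equiv.Perm (Fin d)) :
    cyclePower A d ρ = (ρ.partition.parts.map fun k => (A ^ k).trace).prod := by
  simp [cyclePower, Equiv.Perm.parts_partition]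

end TupleCount

section Asymptotics

theorem tendsto_inv_pow_mul_prod_trace {A : ∀ N : ℕ, Matrix (Fin N) (Fin N) ℂ} {Φ : ℕ → ℂ}
    (hA : ∀ k : ℕ, 1 ≤ k → Filter.Tendsto
      (fun N : ℕ => (N : ℂ)⁻¹ * ((A N) ^ k).trace) Filter.atTop (nhds (Φ k)))
    (s : Multiset ℕ) (hs : ∀ k ∈ s, 1 ≤ k) :
    Filter.Tendsto (fun N : ℕ => ((N : ℂ)⁻¹) ^ s.card * (s.map fun k => ((A N) ^ k).trace).prod)
      Filter.atTop (nhds (s.map Φ).prod) := by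
  induction s using Multiset.induction_on with
  | empty => simp
  | cons a s ih =>
    have h := (hA a (hs a (by simp))).mul (ih fun k hk => hs k (by simp [hk]))
    rw [Multiset.map_cons, Multiset.prod_cons]
    refine h.congr fun N => ?_
    rw [Multiset.map_cons, Multiset.prod_cons, Multiset.card_cons, pow_succ]
    ring

theorem tendsto_tsum_inv_pow {n : ℕ → ℕ} {D m : ℕ} (hn : ∀ r, n r ≤ D ^ r)
    (hn0 : ∀ r, r + 2 < m → n r = 0) (hm : 2 ≤ m) :
    Filter.Tendsto (fun N : ℕ => (N : ℂ) ^ m * ((N : ℂ) ^ 2)⁻¹ * ∑' r, (-(N : ℂ)⁻¹) ^ r * n r)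
      Filter.atTop (nhds ((-1) ^ m * n (m - 2))) := by
  set h : ℕ → ℕ → ℂ := fun N r => (-1) ^ r * ((N : ℂ)⁻¹) ^ (r + 2 - m) * n r with hh
  have hterm : ∀ N r : ℕ, N ≠ 0 →
      (N : ℂ) ^ m * ((N : ℂ) ^ 2)⁻¹ * ((-(N : ℂ)⁻¹) ^ r * n r) = h N r := by
    intro N r hN
    have hN : (N : ℂ) ≠ 0 := Nat.cast_ne_zero.2 hN
    by_cases hr : r + 2 < m
    · simp [hh, hn0 r hr]
    · have h1 : (N : ℂ)⁻¹ ^ (r + 2) = (N : ℂ)⁻¹ ^ (r + 2 - m) * (N : ℂ)⁻¹ ^ m := by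
        rw [← pow_add, Nat.sub_add_cancel (not_lt.1 hr)]
      have h2 : (N : ℂ) ^ m * (N : ℂ)⁻¹ ^ m = 1 := by rw [← mul_pow, mul_inv_cancel₀ hN, one_pow]
      calc _ = (-1) ^ r * ((N : ℂ) ^ m * (N : ℂ)⁻¹ ^ (r + 2)) * n r := by
            rw [neg_pow, ← inv_pow, pow_add]; ring
        _ = (-1) ^ r * ((N : ℂ)⁻¹ ^ (r + 2 - m) * ((N : ℂ) ^ m * (N : ℂ)⁻¹ ^ m)) * n r := by
            rw [h1]; ring
        _ = _ := by rw [h2, mul_one]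
  have hlim : Filter.Tendsto (fun N => ∑' r, h N r) Filter.atTop
      (nhds (∑' r, if r = m - 2 then (-1) ^ m * (n (m - 2) : ℂ) else 0)) := by
    refine tendsto_tsum_of_dominated_convergence
      (bound := fun r => (2 * D : ℝ) ^ (m - 2) * (1 / 2) ^ r) ?_ (fun r => ?_) ?_
    · exact (summable_geometric_of_lt_one (by norm_num) (by norm_num)).mul_left _
    · rcases lt_trichotomy (r + 2) m with hr | hr | hr
      · simp [hh, hn0 r hr, show r ≠ m - 2 by omega]
      · subst hr
        simp [hh, pow_add]
      · have h0 : Filter.Tendsto (fun N : ℕ => (N : ℂ)⁻¹) Filter.atTop (nhds 0) :=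
          tendsto_inv_atTop_nhds_zero_nat
        have h1 := ((h0.pow (r + 2 - m)).const_mul ((-1 : ℂ) ^ r)).mul_const (n r : ℂ)
        rw [zero_pow (by omega), mul_zero, zero_mul] at h1
        rw [if_neg (by omega)]
        exact h1
    · filter_upwards [Filter.eventually_ge_atTop (2 * D + 1)] with N hN r
      by_cases hr : r + 2 < m
      · simp only [hh, hn0 r hr, Nat.cast_zero, mul_zero, norm_zero]
        positivity
      · obtain ⟨j, rfl⟩ : ∃ j, r = (m - 2) + j := ⟨r - (m - 2), by omega⟩
        have hj : m - 2 + j + 2 - m = j := by omega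
        have hN0 : (0 : ℝ) < N := by exact_mod_cast (by omega : 0 < N)
        have h1 : (N : ℝ)⁻¹ * D ≤ 1 / 2 := by
          rw [inv_mul_le_iff₀ hN0]
          have : ((2 * D + 1 : ℕ) : ℝ) ≤ N := by exact_mod_cast hN
          push_cast at this
          linarith
        have h2 : (n (m - 2 + j) : ℝ) ≤ (D : ℝ) ^ (m - 2 + j) := by exact_mod_cast hn _
        calc ‖h N (m - 2 + j)‖ = ((N : ℝ)⁻¹) ^ j * n (m - 2 + j) := by simp [hh, hj]
          _ ≤ ((N : ℝ)⁻¹) ^ j * (D : ℝ) ^ (m - 2 + j) := by gcongr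
          _ = (D : ℝ) ^ (m - 2) * ((N : ℝ)⁻¹ * D) ^ j := by rw [mul_pow, pow_add]; ring
          _ ≤ (D : ℝ) ^ (m - 2) * (1 / 2) ^ j := by gcongr
          _ = (2 * D : ℝ) ^ (m - 2) * (1 / 2) ^ (m - 2 + j) := by
            have h3 : (2 : ℝ) ^ (m - 2) * (1 / 2) ^ (m - 2) = 1 := by rw [← mul_pow]; norm_num
            rw [pow_add, mul_pow]
            linear_combination (-(D : ℝ) ^ (m - 2) * (1 / 2) ^ j) * h3
  rw [tsum_ite_eq] at hlim
  refine hlim.congr' ?_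
  filter_upwards [Filter.eventually_ge_atTop 1] with N hN
  rw [← tsum_mul_left]
  exact tsum_congr fun r => (hterm N r (by omega)).symm

variable {d : ℕ}

/-- The cycle type of `ρ`, as a partition of `d`. -/
def cycleTypePartition (ρ : Equiv.Perm (Fin d)) : d.Partition :=
  ⟨ρ.partition.parts, ρ.partition.parts_pos, by rw [ρ.partition.parts_sum, Fintype.card_fin]⟩

theorem hasCycleType_iff {ρ : Equiv.Perm (Fin d)} {α : d.Partition} :
    HasCycleType ρ α ↔ cycleTypePartition ρ = α :=
  ⟨fun h => Nat.Partition.ext h, fun h => h ▸ rfl⟩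

theorem Cseq_zero_eq_sum (Φ Ψ : ℕ → ℂ) : Cseq 0 d Φ Ψ =
    ∑ ρ : Equiv.Perm (Fin d), ∑ σ : Equiv.Perm (Fin d),
      (-1) ^ d * (ρ.partition.parts.map Φ).prod * (σ.partition.parts.map Ψ).prod *
        ((-1) ^ (ρ.partition.parts.card + σ.partition.parts.card) *
          tupleCount ρ σ (ρ.partition.parts.card + σ.partition.parts.card - 2)) := by
  classical
  have h1 : ∀ α β : d.Partition, (-1 : ℂ) ^ (d + α.parts.card + β.parts.card) *
      (Hg d 0 α β : ℂ) * momProd Φ α * momProd Ψ β =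
      ∑ ρ : Equiv.Perm (Fin d), ∑ σ : Equiv.Perm (Fin d),
        if cycleTypePartition σ = β then if cycleTypePartition ρ = α then
          (-1) ^ d * (α.parts.map Φ).prod * (β.parts.map Ψ).prod *
            ((-1) ^ (α.parts.card + β.parts.card) *
              (tupleCount ρ σ (α.parts.card + β.parts.card - 2) : ℂ)) else 0 else 0 := by
    intro α β
    rw [Hg, mul_zero, zero_add, Hr_eq_sum]
    push_cast
    simp only [Finset.mul_sum, Finset.sum_mul]
    refine Finset.sum_congr rfl fun ρ _ => Finset.sum_congr rfl fun σ _ => ?_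
    rw [hasCycleType_iff, hasCycleType_iff, momProd, momProd]
    by_cases hρ : cycleTypePartition ρ = α <;> by_cases hσ : cycleTypePartition σ = β
    · simp only [hρ, hσ, and_self, if_true, pow_add]
      ring
    all_goals simp [hρ, hσ]
  rw [Cseq]
  simp only [h1]
  have h2 : ∀ f : d.Partition → d.Partition → Equiv.Perm (Fin d) → Equiv.Perm (Fin d) → ℂ,
      ∑ α, ∑ β, ∑ ρ, ∑ σ, f α β ρ σ = ∑ ρ, ∑ σ, ∑ α, ∑ β, f α β ρ σ := by
    intro f
    calc _ = ∑ α, ∑ ρ, ∑ β, ∑ σ, f α β ρ σ := Finset.sum_congr rfl fun _ _ => Finset.sum_comm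
      _ = ∑ α, ∑ ρ, ∑ σ, ∑ β, f α β ρ σ := Finset.sum_congr rfl fun _ _ =>
          Finset.sum_congr rfl fun _ _ => Finset.sum_comm
      _ = ∑ ρ, ∑ α, ∑ σ, ∑ β, f α β ρ σ := Finset.sum_comm
      _ = _ := Finset.sum_congr rfl fun _ _ => Finset.sum_comm
  rw [h2]
  refine Finset.sum_congr rfl fun ρ _ => Finset.sum_congr rfl fun σ _ => ?_
  simp only [Finset.sum_ite_eq, Finset.mem_univ, if_true]
  rfl

theorem tendsto_factSeries (hd : d ≠ 0) {A B : ∀ N : ℕ, Matrix (Fin N) (Fin N) ℂ}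
    {Φ Ψ : ℕ → ℂ}
    (hA : ∀ k : ℕ, 1 ≤ k → Filter.Tendsto
      (fun N : ℕ => (N : ℂ)⁻¹ * ((A N) ^ k).trace) Filter.atTop (nhds (Φ k)))
    (hB : ∀ k : ℕ, 1 ≤ k → Filter.Tendsto
      (fun N : ℕ => (N : ℂ)⁻¹ * ((B N) ^ k).trace) Filter.atTop (nhds (Ψ k))) :
    Filter.Tendsto (fun N : ℕ => ((N : ℂ) ^ 2)⁻¹ * factSeries (A N) (B N) (-(N : ℂ)⁻¹)
      (Finset.univ : Finset (Fin d)) (FactTransitive Finset.univ)) Filter.atTop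
      (nhds (Cseq 0 d Φ Ψ)) := by
  have hcard : ∀ ρ : Equiv.Perm (Fin d), 1 ≤ ρ.partition.parts.card := fun ρ => by
    rw [Nat.one_le_iff_ne_zero, ne_eq, Multiset.card_eq_zero]
    intro h
    have := ρ.partition.parts_sum
    rw [h, Fintype.card_fin] at this
    exact hd this.symm
  rw [Cseq_zero_eq_sum]
  have hlim := tendsto_finsetSum (Finset.univ : Finset (Equiv.Perm (Fin d))) fun ρ _ =>
    tendsto_finsetSum (Finset.univ : Finset (Equiv.Perm (Fin d))) fun σ _ =>
      (((tendsto_inv_pow_mul_prod_trace hA ρ.partition.parts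
        fun k hk => ρ.partition.parts_pos hk).const_mul ((-1 : ℂ) ^ d)).mul
        (tendsto_inv_pow_mul_prod_trace hB σ.partition.parts
          fun k hk => σ.partition.parts_pos hk)).mul
        (tendsto_tsum_inv_pow (m := ρ.partition.parts.card + σ.partition.parts.card)
          (tupleCount_le ρ σ) (fun r => tupleCount_eq_zero)
          (by have := hcard ρ; have := hcard σ; omega))
  refine hlim.congr' ?_
  filter_upwards [Filter.eventually_gt_atTop (d * d)] with N hN
  have hN0 : (N : ℂ) ≠ 0 := Nat.cast_ne_zero.2 (by omega)
  have ht : ‖-(N : ℂ)⁻¹‖ * Fintype.card (Fin d × Fin d) < 1 := by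
    rw [norm_neg, norm_inv, Complex.norm_natCast, inv_mul_lt_iff₀ (by
      exact_mod_cast (by omega : 0 < N))]
    simpa using (by exact_mod_cast hN : (d : ℝ) * d < N)
  rw [factSeries_eq_sum_tupleCount _ _ ht, Finset.mul_sum]
  refine Finset.sum_congr rfl fun ρ _ => ?_
  rw [Finset.mul_sum]
  refine Finset.sum_congr rfl fun σ _ => ?_
  rw [cyclePower_eq_prod_parts, cyclePower_eq_prod_parts, pow_add]
  have h : ∀ k, (N : ℂ)⁻¹ ^ k * (N : ℂ) ^ k = 1 := fun k => by
    rw [← mul_pow, inv_mul_cancel₀ hN0, one_pow]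
  linear_combination ((-1) ^ d * (ρ.partition.parts.map fun k => ((A N) ^ k).trace).prod *
    (σ.partition.parts.map fun k => ((B N) ^ k).trace).prod * ((N : ℂ) ^ 2)⁻¹ *
    ∑' r, (-(N : ℂ)⁻¹) ^ r * (tupleCount ρ σ r : ℂ)) *
    ((N : ℂ)⁻¹ ^ σ.partition.parts.card * (N : ℂ) ^ σ.partition.parts.card *
      h ρ.partition.parts.card + h σ.partition.parts.card)

end Asymptotics

theorem IsFreeEnergyBranch.re_le {N : ℕ} (hN : 1 ≤ N)
    {μ : Measure (Matrix.unitaryGroup (Fin N) ℂ)} [IsProbabilityMeasure μ]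
    {A B : Matrix (Fin N) (Fin N) ℂ} {M r : ℝ} (hM : 0 ≤ M) (hA : opNorm A ≤ M)
    (hB : opNorm B ≤ M) {F : ℂ → ℂ} (hF : IsFreeEnergyBranch μ A B r F) {z : ℂ}
    (hz : z ∈ Metric.ball (0 : ℂ) r) : (F z).re ≤ r * M ^ 2 := by
  have h1 := norm_hciz_le μ hM hA hB z
  rw [← hF.2.2 z hz, Complex.norm_exp, Real.exp_le_exp] at h1
  have h2 : ((N : ℂ) ^ 2 * F z).re = (N : ℝ) ^ 2 * (F z).re := by
    rw [← Complex.ofReal_natCast, ← Complex.ofReal_pow, Complex.re_ofReal_mul]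
  have hN0 : (0 : ℝ) < (N : ℝ) ^ 2 := by positivity
  have h3 : ‖z‖ ≤ r := (mem_ball_zero_iff.1 hz).le
  rw [h2, mul_left_comm] at h1
  exact (le_of_mul_le_mul_left h1 hN0).trans (by gcongr)

theorem IsFreeEnergyBranch.iteratedDeriv_eq {N : ℕ}
    {μ : Measure (Matrix.unitaryGroup (Fin N) ℂ)} [μ.IsHaarMeasure] [IsProbabilityMeasure μ]
    {A B : Matrix (Fin N) (Fin N) ℂ} {r : ℝ} (hr : 0 < r) {F : ℂ → ℂ}
    (hF : IsFreeEnergyBranch μ A B r F) {d : ℕ} (hd : d ≠ 0) (hN : d * d < N) :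
    iteratedDeriv d F 0 = ((N : ℂ) ^ 2)⁻¹ * factSeries A B (-(N : ℂ)⁻¹)
      (Finset.univ : Finset (Fin d)) (FactTransitive Finset.univ) := by
  have hball : Metric.ball (0 : ℂ) r ∈ nhds 0 := Metric.ball_mem_nhds 0 hr
  have hFan : AnalyticAt ℂ F 0 := hF.1.analyticAt hball
  have hN0 : N ≠ 0 := by omega
  have ht : ‖-(N : ℂ)⁻¹‖ * Fintype.card (Fin d × Fin d) < 1 := by
    rw [norm_neg, norm_inv, Complex.norm_natCast, inv_mul_lt_iff₀ (by
      exact_mod_cast (by omega : 0 < N))]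
    simpa using (by exact_mod_cast hN : (d : ℝ) * d < N)
  have hdN : d ≤ N := (Nat.le_mul_self d).trans hN.le
  have : NeZero d := ⟨hd⟩
  rw [factSeries_eq_iteratedDeriv_log μ A B hN0 ht (by simpa using hdN)
    (f := fun z => (N : ℂ) ^ 2 * F z) (analyticAt_const.mul hFan) (by simp [hF.2.1])
    (Filter.eventually_of_mem hball hF.2.2) ⟨0, Finset.mem_univ _⟩, Finset.card_univ,
    Fintype.card_fin, iteratedDeriv_const_mul_field, inv_mul_cancel_left₀ (by simpa using hN0)]

/-- Under the HCIZ non-vanishing hypothesis, the free energy `F_N` converges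
pointwise to `C_0(z;Φ,Ψ)` on `D(0,r)`, `r = min(R, (2/27)M⁻²)`. -/
theorem free_energy_tendsto_pointwise (M : ℝ) (hM : 0 < M) (Φ Ψ : ℕ → ℂ)
    (A B : ∀ N : ℕ, Matrix (Fin N) (Fin N) ℂ)
    (hAnormal : ∀ N, IsStarNormal (A N)) (hBnormal : ∀ N, IsStarNormal (B N))
    (hAbd : ∀ N, opNorm (A N) ≤ M) (hBbd : ∀ N, opNorm (B N) ≤ M)
    (hAmom : ∀ k : ℕ, 1 ≤ k → Filter.Tendsto
      (fun N : ℕ => (N : ℂ)⁻¹ * ((A N) ^ k).trace) Filter.atTop (nhds (Φ k)))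
    (hBmom : ∀ k : ℕ, 1 ≤ k → Filter.Tendsto
      (fun N : ℕ => (N : ℂ)⁻¹ * ((B N) ^ k).trace) Filter.atTop (nhds (Ψ k)))
    (μ : ∀ N : ℕ, Measure (Matrix.unitaryGroup (Fin N) ℂ))
    (hμ : ∀ N, (μ N).IsHaarMeasure) (hμprob : ∀ N, IsProbabilityMeasure (μ N))
    (R : ℝ) (hR : 0 < R)
    (hnz : ∀ N : ℕ, 1 ≤ N → ∀ z : ℂ, ‖z‖ < R → hciz (μ N) (A N) (B N) z ≠ 0)
    (r : ℝ) (hr : r = min R (2 / 27 * (M ^ 2)⁻¹))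
    (F : ℕ → ℂ → ℂ)
    (hF : ∀ N : ℕ, 1 ≤ N → IsFreeEnergyBranch (μ N) (A N) (B N) r (F N)) :
    ∀ z₀ : ℂ, ‖z₀‖ < r →
      Filter.Tendsto (fun N : ℕ => F N z₀) Filter.atTop (nhds (C0fun Φ Ψ z₀)) := by
  intro z₀ hz₀
  have hr0 : 0 < r := by rw [hr]; positivity
  refine tendsto_of_re_le_of_tendsto_iteratedDeriv (K := r * M ^ 2)
    (c := fun d => Cseq 0 d Φ Ψ) (by positivity) (fun N hN => (hF N hN).1)
    (fun N hN => (hF N hN).2.1)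
    (fun N hN z hz => (hF N hN).re_le hN hM.le (hAbd N) (hBbd N) hz) (fun d => ?_) hz₀
  refine (tendsto_factSeries d.succ_ne_zero hAmom hBmom).congr' ?_
  filter_upwards [Filter.eventually_gt_atTop ((d + 1) * (d + 1))] with N hN
  exact ((hF N (by omega)).iteratedDeriv_eq hr0 d.succ_ne_zero hN).symm

end HCIZ
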